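/- (Estimate (3.17).) Let N ≥ 2 and N ≤ p < 2N − 1. There exists C > 0, depending only on N, p and the Littlewood–Paley function, such that for all u, B ∈ C_c^∞((0,∞)×ℝ^N; ℝ^N), the divergence correction V₆(u,B) := ∑_{i,k=1}^N P_{ki} ∂_k B_i satisfies ‖∇V₆(u,B)‖_{L¹(ℝ₊;Ḃ^{−1+N/p}_{p,1}(ℝ^N))} ≤ C ( ∑_{r=1}^{N−1} E(u)^r ) ‖D²B‖_{L¹(ℝ₊;Ḃ^{−1+N/p}_{p,1}(ℝ^N))}. -/

import Mathlib

open MeasureTheory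
open scoped BigOperators ENNReal

noncomputable section

namespace MHD

/-- A Littlewood–Paley function on a finite-dimensional real inner product space:
a nonnegative, smooth, radial, radially nonincreasing function equal to `1` on the unit
ball and supported in the ball of radius `2`. -/
structure LPF (V : Type*) [NormedAddCommGroup V] [InnerProductSpace ℝ V]
    [FiniteDimensional ℝ V] [MeasurableSpace V] [BorelSpace V] where
  chi : V → ℝ
  smooth : ContDiff ℝ (⊤ : ℕ∞) chi
  nonneg : ∀ x, 0 ≤ chi x
  radial : ∀ x y : V, ‖x‖ = ‖y‖ → chi x = chi y
  radial_antitone : ∀ x y : V, ‖x‖ ≤ ‖y‖ → chi y ≤ chi x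
  eq_one : ∀ x : V, ‖x‖ ≤ 1 → chi x = 1
  supp : ∀ x : V, 2 ≤ ‖x‖ → chi x = 0

variable {V : Type*} [NormedAddCommGroup V] [InnerProductSpace ℝ V]
    [FiniteDimensional ℝ V] [MeasurableSpace V] [BorelSpace V]

/-- `φ̂(ξ) = χ̂(ξ/2) − χ̂(ξ)`. -/
def LPF.phiHat (χ : LPF V) (ξ : V) : ℝ := χ.chi ((2 : ℝ)⁻¹ • ξ) - χ.chi ξ

/-- The `k`-th homogeneous Littlewood–Paley block `Δ̇_k f = 𝓕⁻¹(φ̂(2^{-k}·)·𝓕f)`. -/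
def LPF.block (χ : LPF V) (k : ℤ) (f : V → ℂ) : V → ℂ :=
  FourierTransformInv.fourierInv
    (fun ξ : V => ((χ.phiHat ((2 : ℝ) ^ (-k) • ξ) : ℝ) : ℂ) * FourierTransform.fourier f ξ)

/-- The `k`-th Littlewood–Paley kernel `𝓕⁻¹(φ̂(2^{-k}·))`. -/
def LPF.kernel (χ : LPF V) (k : ℤ) : V → ℂ :=
  FourierTransformInv.fourierInv (fun ξ : V => ((χ.phiHat ((2 : ℝ) ^ (-k) • ξ) : ℝ) : ℂ))

/-- The homogeneous Besov norm `‖f‖_{Ḃ^s_{p,1}} = ∑_{k∈ℤ} 2^{sk} ‖Δ̇_k f‖_{L^p} ∈ [0,∞]`. -/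
def besov (χ : LPF V) (s p : ℝ) (f : V → ℂ) : ℝ≥0∞ :=
  ∑' k : ℤ, ENNReal.ofReal ((2 : ℝ) ^ (s * (k : ℝ))) *
    eLpNorm (χ.block k f) (ENNReal.ofReal p) volume

/-- The space-time norm `∫_I ‖u(t,·)‖_{Ḃ^s_{p,1}} dt ∈ [0,∞]`. -/
def besovT (χ : LPF V) (s p : ℝ) (I : Set ℝ) (u : ℝ → V → ℂ) : ℝ≥0∞ :=
  ∫⁻ t in I, besov χ s p (u t)

/-- Euclidean space `ℝ^n`. -/
abbrev Euc (n : ℕ) := EuclideanSpace ℝ (Fin n)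

/-- Partial derivative `∂_i f` in the `i`-th coordinate direction. -/
def pdv {n : ℕ} {F : Type*} [NormedAddCommGroup F] [NormedSpace ℝ F]
    (i : Fin n) (f : Euc n → F) (y : Euc n) : F :=
  fderiv ℝ f y (EuclideanSpace.single i 1)

/-- `u ∈ C_c^∞((0,∞) × ℝ^N ; F)`. -/
def SmoothCpt (N : ℕ) {F : Type*} [NormedAddCommGroup F] [NormedSpace ℝ F]
    (u : ℝ → Euc N → F) : Prop :=
  ContDiff ℝ (⊤ : ℕ∞) (Function.uncurry u) ∧ HasCompactSupport (Function.uncurry u) ∧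
    ∀ t : ℝ, t ≤ 0 → ∀ y, u t y = 0

/-- `Q` is the family of cofactor polynomials: `Q i j` has zero constant term and
`adjugate (1 + M) i j = δ_{ij} + (Q i j)(M)` for every real `N × N` matrix `M`. -/
def IsCofactorPoly (N : ℕ) (Q : Fin N → Fin N → MvPolynomial (Fin N × Fin N) ℝ) : Prop :=
  ∀ i j : Fin N,
    MvPolynomial.constantCoeff (Q i j) = 0 ∧
    ∀ M : Matrix (Fin N) (Fin N) ℝ,
      Matrix.adjugate (1 + M) i j =
        (if i = j then (1 : ℝ) else 0) +
          MvPolynomial.eval (fun v : Fin N × Fin N => M v.1 v.2) (Q i j)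

/-- The matrix field `P_{ij}(t,y) = Q_{ij}(∫₀ᵗ Du(τ,y) dτ)`. -/
def Pmat {N : ℕ} (Q : Fin N → Fin N → MvPolynomial (Fin N × Fin N) ℝ)
    (u : ℝ → Euc N → Euc N) (t : ℝ) (y : Euc N) (i j : Fin N) : ℝ :=
  MvPolynomial.eval
    (fun v : Fin N × Fin N => ∫ τ in (0 : ℝ)..t, pdv v.2 (fun z => u τ z v.1) y) (Q i j)

/-- `E(u) = ‖D²u‖_{L¹(ℝ₊; Ḃ^s_{p,1}(ℝ^N))}`, summed over all components and all pairs of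
spatial derivatives. -/
def EE {N : ℕ} (χ : LPF (Euc N)) (s p : ℝ) (u : ℝ → Euc N → Euc N) : ℝ≥0∞ :=
  ∑ m : Fin N, ∑ i : Fin N, ∑ j : Fin N,
    besovT χ s p (Set.Ioi 0) (fun t y => ((pdv i (pdv j fun z => u t z m) y : ℝ) : ℂ))

/-- `‖∂_t u‖_{L¹(ℝ₊; Ḃ^s_{p,1}(ℝ^N))}`, summed over components. -/
def dtNorm {N : ℕ} (χ : LPF (Euc N)) (s p : ℝ) (u : ℝ → Euc N → Euc N) : ℝ≥0∞ :=
  ∑ m : Fin N,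
    besovT χ s p (Set.Ioi 0) (fun t y => ((deriv (fun τ => u τ y m) t : ℝ) : ℂ))

end MHD

open MHD

noncomputable section

namespace MHD

section Auxiliary

set_option linter.unusedSectionVars false

open SchwartzMap FourierTransform Filter Topology NNReal

section Minkowski

variable {X Y : Type*} [MeasurableSpace X] [MeasurableSpace Y]

/-- Minkowski's integral inequality, for a dominated function of finite `L^p` size. -/
theorem lintegral_rpow_le_lintegral_of_le {μ : Measure X} {ν : Measure Y} [SFinite μ] [SFinite ν]
    {p : ℝ} (hp : 1 < p) {h : X → ℝ≥0∞} {F : X → Y → ℝ≥0∞} (hh : Measurable h)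
    (hF : Measurable (Function.uncurry F)) (hle : ∀ x, h x ≤ ∫⁻ y, F x y ∂ν)
    (hfin : ∫⁻ x, h x ^ p ∂μ ≠ ∞) :
    (∫⁻ x, h x ^ p ∂μ) ^ (1 / p) ≤ ∫⁻ y, (∫⁻ x, F x y ^ p ∂μ) ^ (1 / p) ∂ν := by
  obtain ⟨q, hpq⟩ : ∃ q, p.HolderConjugate q := ⟨_, Real.HolderConjugate.conjExponent hp⟩
  set I := ∫⁻ x, h x ^ p ∂μ with hI
  have hp0 : 0 < p := hpq.pos
  by_cases hI0 : I = 0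
  · simp [hI0, hp0]
  have hq : (p - 1) * q = p := by
    have := hpq.sub_one_mul_conj; simpa using this
  have key : I ≤ (∫⁻ y, (∫⁻ x, F x y ^ p ∂μ) ^ (1 / p) ∂ν) * I ^ (1 / q) := by
    calc I = ∫⁻ x, h x ^ (p - 1) * h x ∂μ := by
          refine lintegral_congr fun x => ?_
          conv_rhs => rw [← ENNReal.rpow_one (h x), ← ENNReal.rpow_mul, one_mul]
          rw [← ENNReal.rpow_add_of_nonneg _ _ (by linarith) (by norm_num)]
          congr 1; ring
      _ ≤ ∫⁻ x, ∫⁻ y, h x ^ (p - 1) * F x y ∂ν ∂μ := by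
          refine lintegral_mono fun x => ?_
          rw [lintegral_const_mul _ (hF.of_uncurry_left)]
          exact mul_le_mul_right (hle x) _
      _ = ∫⁻ y, ∫⁻ x, h x ^ (p - 1) * F x y ∂μ ∂ν := by
          apply lintegral_lintegral_swap
          exact (((hh.comp measurable_fst).pow_const _).mul hF).aemeasurable
      _ ≤ ∫⁻ y, (∫⁻ x, F x y ^ p ∂μ) ^ (1 / p) * I ^ (1 / q) ∂ν := by
          refine lintegral_mono fun y => ?_
          have := ENNReal.lintegral_mul_le_Lp_mul_Lq μ hpq.symm
            (f := fun x => h x ^ (p - 1)) (g := fun x => F x y)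
            (hh.pow_const _).aemeasurable hF.of_uncurry_right.aemeasurable
          refine this.trans (le_of_eq ?_)
          rw [mul_comm]
          congr 3
          ext x
          rw [← ENNReal.rpow_mul, hq]
      _ = _ := by
          rw [lintegral_mul_const _]
          exact (Measurable.lintegral_prod_left (hF.pow_const p)).pow_const _
  have h1 : I = I ^ (1 / p) * I ^ (1 / q) := by
    rw [← ENNReal.rpow_add _ _ hI0 hfin]
    have := hpq.inv_add_inv_eq_one
    simp only [one_div, this, ENNReal.rpow_one]
  have hne : I ^ (1 / q) ≠ 0 := by
    have : 0 < 1 / q := one_div_pos.2 hpq.symm.pos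
    simp [hI0, hfin]
  have hnt : I ^ (1 / q) ≠ ∞ := ENNReal.rpow_ne_top_of_nonneg (one_div_pos.2 hpq.symm.pos).le hfin
  nth_rw 1 [h1] at key
  exact (ENNReal.mul_le_mul_iff_left hne hnt).1 key

theorem eLpNorm_ofReal_eq {μ : Measure X} {p : ℝ} (hp : 0 < p) (f : X → ℂ) :
    eLpNorm f (ENNReal.ofReal p) μ = (∫⁻ x, ‖f x‖ₑ ^ p ∂μ) ^ (1 / p) := by
  rw [eLpNorm_eq_lintegral_rpow_enorm_toReal (by simpa using hp) ENNReal.ofReal_ne_top,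
    ENNReal.toReal_ofReal hp.le]

theorem eLpNorm_le_lintegral_eLpNorm {μ : Measure X} {ν : Measure Y} [SFinite μ] [SFinite ν]
    {p : ℝ} (hp : 1 < p) {h : X → ℂ} {F : X → Y → ℂ} (hh : Measurable h)
    (hF : Measurable (Function.uncurry F)) (hle : ∀ x, ‖h x‖ₑ ≤ ∫⁻ y, ‖F x y‖ₑ ∂ν)
    (hfin : eLpNorm h (ENNReal.ofReal p) μ ≠ ∞) :
    eLpNorm h (ENNReal.ofReal p) μ ≤
      ∫⁻ y, eLpNorm (fun x => F x y) (ENNReal.ofReal p) μ ∂ν := by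
  have hp0 : 0 < p := by linarith
  simp only [eLpNorm_ofReal_eq hp0] at hfin ⊢
  refine lintegral_rpow_le_lintegral_of_le hp hh.enorm hF.enorm hle fun h => hfin ?_
  rw [h, ENNReal.top_rpow_of_pos (one_div_pos.2 hp0)]

end Minkowski

section Multiplier

variable {V : Type*} [NormedAddCommGroup V] [InnerProductSpace ℝ V]
    [FiniteDimensional ℝ V] [MeasurableSpace V] [BorelSpace V]

/-- Dilation by a nonzero scalar, as a continuous linear equivalence. -/
def dilEquiv (c : ℝ) (hc : c ≠ 0) : V ≃L[ℝ] V :=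
  ContinuousLinearEquiv.smulLeft (Units.mk0 c hc)

/-- The dilated symbol `m(2^{-k}·)`. -/
def dil (m : 𝓢(V, ℂ)) (k : ℤ) : 𝓢(V, ℂ) :=
  compCLMOfContinuousLinearEquiv ℂ (dilEquiv ((2 : ℝ) ^ (-k)) (by positivity)) m

theorem dil_apply (m : 𝓢(V, ℂ)) (k : ℤ) (ξ : V) : dil m k ξ = m ((2 : ℝ) ^ (-k) • ξ) := rfl

/-- The inverse Fourier transform of a Schwartz function, as a Schwartz function. -/
def invF (m : 𝓢(V, ℂ)) : 𝓢(V, ℂ) := 𝓕⁻ m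

/-- The Fourier multiplier with symbol `m(2^{-k}·)`. -/
def op (m : 𝓢(V, ℂ)) (k : ℤ) (f : 𝓢(V, ℂ)) : 𝓢(V, ℂ) :=
  SchwartzMap.convolution (ContinuousLinearMap.mul ℂ ℂ) (invF (dil m k)) f

/-- Pointwise product of Schwartz functions. -/
def pmul (f g : 𝓢(V, ℂ)) : 𝓢(V, ℂ) := pairing (ContinuousLinearMap.mul ℂ ℂ) f g

theorem pmul_apply (f g : 𝓢(V, ℂ)) (x : V) : pmul f g x = f x * g x := rfl

theorem fourier_op (m : 𝓢(V, ℂ)) (k : ℤ) (f : 𝓢(V, ℂ)) (ξ : V) :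
    𝓕 (op m k f) ξ = m ((2 : ℝ) ^ (-k) • ξ) * 𝓕 f ξ := by
  rw [op, SchwartzMap.fourier_convolution]
  simp [dil_apply, invF]

theorem ext_fourier {f g : 𝓢(V, ℂ)} (h : ∀ ξ, 𝓕 f ξ = 𝓕 g ξ) : f = g := by
  have : (𝓕 f : 𝓢(V, ℂ)) = 𝓕 g := SchwartzMap.ext h
  simpa using congrArg (fun h : 𝓢(V, ℂ) => (𝓕⁻ h : 𝓢(V, ℂ))) this

theorem op_apply (m : 𝓢(V, ℂ)) (k : ℤ) (f : 𝓢(V, ℂ)) (x : V) :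
    op m k f x = ∫ y, invF (dil m k) y * f (x - y) := by
  rw [op, SchwartzMap.convolution_apply]
  rfl

theorem fourierInv_dil (m : 𝓢(V, ℂ)) (k : ℤ) (x : V) :
    invF (dil m k) x =
      ((2 : ℝ) ^ (k * (Module.finrank ℝ V : ℤ)) : ℝ) • invF m ((2 : ℝ) ^ k • x) := by
  rw [invF, invF, fourierInv_coe, fourierInv_coe, Real.fourierInv_eq, Real.fourierInv_eq]
  have := Measure.integral_comp_smul (volume : Measure V)
    (fun v => Real.fourierChar (inner ℝ v ((2 : ℝ) ^ k • x)) • m v) ((2 : ℝ) ^ (-k))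
  simp only [inner_smul_left, inner_smul_right, conj_trivial] at this
  have h2 : (2 : ℝ) ^ k * 2 ^ (-k) = 1 := by
    rw [← zpow_add₀ (by norm_num)]; simp
  convert this using 1
  · refine integral_congr_ae (Eventually.of_forall fun v => ?_)
    simp only [dil_apply]
    rw [← mul_assoc, h2, one_mul]
  · simp only [inner_smul_right]
    congr 1
    rw [abs_of_pos (by positivity), zpow_mul, zpow_neg]
    simp

theorem lintegral_comp_two_zpow_smul (f : V → ℝ≥0∞) (hf : Measurable f) (k : ℤ) :
    ∫⁻ x, f ((2 : ℝ) ^ k • x) =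
      ENNReal.ofReal ((2 : ℝ) ^ (-k * (Module.finrank ℝ V : ℤ))) * ∫⁻ x, f x := by
  have h := Measure.map_addHaar_smul (volume : Measure V) (r := (2 : ℝ) ^ k) (by positivity)
  rw [← lintegral_map (f := f) hf (measurable_const_smul ((2 : ℝ) ^ k)), h, lintegral_smul_measure]
  congr 2
  rw [abs_of_pos (by positivity), zpow_mul, zpow_neg, inv_zpow]
  simp

theorem eLpNorm_fourierInv_dil (m : 𝓢(V, ℂ)) (k : ℤ) {q : ℝ} (hq : 0 < q) :
    eLpNorm (invF (dil m k)) (ENNReal.ofReal q) volume =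
      ENNReal.ofReal ((2 : ℝ) ^ ((k : ℝ) * (Module.finrank ℝ V) * (1 - 1 / q))) *
        eLpNorm (invF m) (ENNReal.ofReal q) volume := by
  set d := Module.finrank ℝ V
  rw [eLpNorm_ofReal_eq hq, eLpNorm_ofReal_eq hq]
  simp only [fourierInv_dil, enorm_smul]
  have hmeas : Measurable fun x => ‖invF m x‖ₑ ^ q :=
    (invF m).continuous.measurable.enorm.pow_const q
  simp only [ENNReal.mul_rpow_of_nonneg _ _ hq.le]
  rw [lintegral_const_mul _ (by exact hmeas.comp (measurable_const_smul ((2 : ℝ) ^ k))),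
    lintegral_comp_two_zpow_smul (fun x => ‖invF m x‖ₑ ^ q) hmeas k, ← mul_assoc,
    ENNReal.mul_rpow_of_nonneg _ _ (by positivity)]
  congr 1
  rw [Real.enorm_eq_ofReal (by positivity), ENNReal.ofReal_rpow_of_nonneg (by positivity) hq.le,
    ← ENNReal.ofReal_mul (by positivity), ENNReal.ofReal_rpow_of_nonneg (by positivity)
      (by positivity)]
  congr 1
  rw [← Real.rpow_intCast, ← Real.rpow_mul (by norm_num), ← Real.rpow_intCast,
    ← Real.rpow_add (by norm_num), ← Real.rpow_mul (by norm_num)]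
  congr 1
  push_cast
  field_simp
  ring

theorem eLpNorm_one_fourierInv_dil (m : 𝓢(V, ℂ)) (k : ℤ) :
    eLpNorm (invF (dil m k)) 1 volume = eLpNorm (invF m) 1 volume := by
  have := eLpNorm_fourierInv_dil m k one_pos
  simpa using this

/-- Uniform `L^p` boundedness of the dilated multipliers. -/
theorem exists_eLpNorm_op_le (m : 𝓢(V, ℂ)) {p : ℝ} (hp : 1 < p) :
    ∃ C : ℝ≥0, ∀ k f, eLpNorm (op m k f) (ENNReal.ofReal p) volume ≤
      C * eLpNorm f (ENNReal.ofReal p) volume := by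
  refine ⟨(eLpNorm (invF m) 1 volume).toNNReal, fun k f => ?_⟩
  rw [ENNReal.coe_toNNReal ((invF m).eLpNorm_lt_top 1 volume).ne, ← eLpNorm_one_fourierInv_dil m k]
  set K := invF (dil m k)
  have h := eLpNorm_le_lintegral_eLpNorm (μ := (volume : Measure V)) (ν := (volume : Measure V)) hp
    (h := op m k f) (F := fun x y => K y * f (x - y)) (op m k f).continuous.measurable
    (by
      have : Continuous (Function.uncurry fun x y => K y * f (x - y)) := by
        have h1 := K.continuous
        have h2 := f.continuous
        unfold Function.uncurry
        fun_prop
      exact this.measurable)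
    (fun x => by rw [op_apply]; exact enorm_integral_le_lintegral_enorm _)
    ((op m k f).eLpNorm_lt_top _ volume).ne
  refine h.trans (le_of_eq ?_)
  rw [eLpNorm_one_eq_lintegral_enorm, ← lintegral_mul_const _ K.continuous.measurable.enorm]
  refine lintegral_congr fun y => ?_
  have h1 : (fun x => K y * f (x - y)) = (K y) • (fun x => f (x - y)) := rfl
  rw [h1, eLpNorm_const_smul]
  congr 1
  exact eLpNorm_comp_measurePreserving f.continuous.aestronglyMeasurable
    (measurePreserving_sub_right volume y)

/-- Uniform `L^∞` boundedness of the dilated multipliers. -/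
theorem enorm_op_le (m : 𝓢(V, ℂ)) (k : ℤ) (f : 𝓢(V, ℂ)) {M : ℝ≥0∞} (hM : ∀ x, ‖f x‖ₑ ≤ M) (x : V) :
    ‖op m k f x‖ₑ ≤ eLpNorm (invF m) 1 volume * M := by
  rw [op_apply, ← eLpNorm_one_fourierInv_dil m k, eLpNorm_one_eq_lintegral_enorm,
    ← lintegral_mul_const _ (invF (dil m k)).continuous.measurable.enorm]
  refine (enorm_integral_le_lintegral_enorm _).trans (lintegral_mono fun y => ?_)
  rw [enorm_mul]
  gcongr
  exact hM _

/-- Bernstein's inequality from `L^p` to `L^∞`. -/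
theorem exists_enorm_op_le (m : 𝓢(V, ℂ)) {p : ℝ} (hp : 1 < p) :
    ∃ C : ℝ≥0, ∀ k f x, ‖op m k f x‖ₑ ≤
      C * ENNReal.ofReal ((2 : ℝ) ^ ((Module.finrank ℝ V : ℝ) / p * k)) *
        eLpNorm f (ENNReal.ofReal p) volume := by
  obtain ⟨q, hpq⟩ : ∃ q, p.HolderConjugate q := ⟨_, Real.HolderConjugate.conjExponent hp⟩
  refine ⟨(eLpNorm (invF m) (ENNReal.ofReal q) volume).toNNReal, fun k f x => ?_⟩
  rw [ENNReal.coe_toNNReal ((invF m).eLpNorm_lt_top _ volume).ne]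
  have h0 : (Module.finrank ℝ V : ℝ) / p * k = (k : ℝ) * (Module.finrank ℝ V) * (1 - 1 / q) := by
    have := hpq.inv_add_inv_eq_one
    rw [one_div, ← this, div_eq_mul_inv]; ring
  rw [h0, mul_comm (eLpNorm _ _ _), ← eLpNorm_fourierInv_dil m k hpq.symm.pos]
  set K := invF (dil m k)
  rw [op_apply]
  refine (enorm_integral_le_lintegral_enorm _).trans ?_
  simp only [enorm_mul]
  have h1 := ENNReal.lintegral_mul_le_Lp_mul_Lq (volume : Measure V) hpq.symm
    (f := fun y => ‖K y‖ₑ) (g := fun y => ‖f (x - y)‖ₑ) K.continuous.measurable.enorm.aemeasurable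
    (f.continuous.comp (continuous_const.sub continuous_id)).measurable.enorm.aemeasurable
  refine h1.trans (le_of_eq ?_)
  rw [eLpNorm_ofReal_eq hpq.symm.pos, eLpNorm_ofReal_eq hpq.pos]
  congr 2
  exact lintegral_sub_left_eq_self (fun y => ‖f y‖ₑ ^ p) x

end Multiplier

theorem sum_Ico_int_succ {M : Type*} [AddCommMonoid M] (h : ℤ → M) {a m : ℤ} (ham : a ≤ m) :
    ∑ j ∈ Finset.Ico a (m + 1), h j = ∑ j ∈ Finset.Ico a m, h j + h m := by
  have : Finset.Ico a (m + 1) = insert m (Finset.Ico a m) := by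
    ext j
    simp only [Finset.mem_Ico, Finset.mem_insert]
    omega
  rw [this, Finset.sum_insert (by simp), add_comm]

section LittlewoodPaley

variable {V : Type*} [NormedAddCommGroup V] [InnerProductSpace ℝ V]
    [FiniteDimensional ℝ V] [MeasurableSpace V] [BorelSpace V]

theorem op_add (m : 𝓢(V, ℂ)) (k : ℤ) (f g : 𝓢(V, ℂ)) : op m k (f + g) = op m k f + op m k g :=
  map_add _ f g

theorem fourier_pmul (a b : 𝓢(V, ℂ)) (ξ : V) :
    𝓕 (pmul a b) ξ = ∫ η, 𝓕 a (-η) * 𝓕 b (ξ + η) := by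
  have h : 𝓕 (pmul a b) ξ =
      SchwartzMap.convolution (ContinuousLinearMap.mul ℂ ℂ) (invF a) (invF b) (-ξ) := by
    have h1 : SchwartzMap.convolution (ContinuousLinearMap.mul ℂ ℂ) (invF a) (invF b) =
        invF (pmul a b) := by
      apply ext_fourier
      intro ζ
      rw [SchwartzMap.fourier_convolution]
      simp [invF, pmul]
    rw [h1, invF, fourierInv_coe, Real.fourierInv_eq_fourier_neg, neg_neg, fourier_coe]
  rw [h, SchwartzMap.convolution_apply, convolution_def]
  refine integral_congr_ae (Eventually.of_forall fun η => ?_)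
  simp only [ContinuousLinearMap.mul_apply']
  rw [invF, invF, fourierInv_coe, fourierInv_coe, Real.fourierInv_eq_fourier_neg,
    Real.fourierInv_eq_fourier_neg, fourier_coe, fourier_coe]
  congr 2
  rw [neg_sub, sub_neg_eq_add, add_comm]

theorem fourier_pmul_eq_zero {a b : 𝓢(V, ℂ)} {R : ℝ} (ha : ∀ ζ, R ≤ ‖ζ‖ → 𝓕 a ζ = 0)
    (hb : ∀ ζ, R ≤ ‖ζ‖ → 𝓕 b ζ = 0) {ξ : V} (hξ : 2 * R ≤ ‖ξ‖) : 𝓕 (pmul a b) ξ = 0 := by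
  rw [fourier_pmul]
  refine integral_eq_zero_of_ae (Eventually.of_forall fun η => ?_)
  by_cases h : R ≤ ‖-η‖
  · simp [ha _ h]
  · have : R ≤ ‖ξ + η‖ := by
      have h1 := norm_sub_le (ξ + η) η
      rw [add_sub_cancel_right] at h1
      rw [norm_neg] at h
      linarith
    simp [hb _ this]

theorem eLpNorm_pmul_le {p : ℝ} (hp : 0 < p) (f g : 𝓢(V, ℂ)) {M : ℝ≥0∞} (hM : ∀ x, ‖f x‖ₑ ≤ M) :
    eLpNorm (pmul f g) (ENNReal.ofReal p) volume ≤ M * eLpNorm g (ENNReal.ofReal p) volume := by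
  rw [eLpNorm_ofReal_eq hp, eLpNorm_ofReal_eq hp]
  calc (∫⁻ x, ‖pmul f g x‖ₑ ^ p) ^ (1 / p) ≤ (∫⁻ x, M ^ p * ‖g x‖ₑ ^ p) ^ (1 / p) := by
        gcongr with x
        rw [pmul_apply, enorm_mul, ENNReal.mul_rpow_of_nonneg _ _ hp.le]
        gcongr
        exact hM x
    _ = _ := by
        rw [lintegral_const_mul _ (g.continuous.measurable.enorm.pow_const p),
          ENNReal.mul_rpow_of_nonneg _ _ (by positivity), ← ENNReal.rpow_mul,
          mul_one_div_cancel hp.ne', ENNReal.rpow_one]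

/-- A smooth function vanishing outside a ball, as a Schwartz function. -/
def ofCpt (m : V → ℂ) (R : ℝ) (hm : ContDiff ℝ (⊤ : ℕ∞) m) (hR : ∀ x, R ≤ ‖x‖ → m x = 0) :
    𝓢(V, ℂ) :=
  HasCompactSupport.toSchwartzMap (f := m)
    (HasCompactSupport.intro (isCompact_closedBall (0 : V) R) fun x hx => hR x (by
      simp only [Metric.mem_closedBall, dist_zero_right, not_le] at hx; exact hx.le)) hm

variable (χ : LPF V)

theorem LPF.contDiff_comp_smul (c : ℝ) :
    ContDiff ℝ (⊤ : ℕ∞) fun ξ : V => ((χ.chi (c • ξ) : ℝ) : ℂ) :=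
  Complex.ofRealCLM.contDiff.comp (χ.smooth.comp (contDiff_const_smul c))

/-- The low-frequency symbol `χ̂` as a Schwartz function. -/
def LPF.chiS : 𝓢(V, ℂ) :=
  ofCpt (fun ξ => ((χ.chi ξ : ℝ) : ℂ)) 2 (by simpa using χ.contDiff_comp_smul 1)
    (fun x hx => by simp [χ.supp x hx])

/-- The enlarged low-frequency symbol `χ̂(·/4)` as a Schwartz function. -/
def LPF.chiWide : 𝓢(V, ℂ) :=
  ofCpt (fun ξ => ((χ.chi ((4 : ℝ)⁻¹ • ξ) : ℝ) : ℂ)) 8 (χ.contDiff_comp_smul _)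
    (fun x hx => by
      rw [χ.supp, Complex.ofReal_zero]
      rw [norm_smul, Real.norm_of_nonneg (by norm_num)]; linarith)

theorem LPF.phiHat_eq_zero_of_four_le {ξ : V} (h : 4 ≤ ‖ξ‖) : χ.phiHat ξ = 0 := by
  rw [LPF.phiHat, χ.supp, χ.supp ξ (by linarith), sub_zero]
  rw [norm_smul, Real.norm_of_nonneg (by norm_num)]; linarith

theorem LPF.phiHat_eq_zero_of_le_one {ξ : V} (h : ‖ξ‖ ≤ 1) : χ.phiHat ξ = 0 := by
  rw [LPF.phiHat, χ.eq_one, χ.eq_one ξ h, sub_self]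
  rw [norm_smul, Real.norm_of_nonneg (by norm_num)]; linarith

/-- The symbol `φ̂` as a Schwartz function. -/
def LPF.phiS : 𝓢(V, ℂ) :=
  ofCpt (fun ξ => ((χ.phiHat ξ : ℝ) : ℂ)) 4
    (by
      have := (χ.contDiff_comp_smul (2 : ℝ)⁻¹).sub (χ.contDiff_comp_smul 1)
      simpa [LPF.phiHat] using this)
    (fun x hx => by simp [χ.phiHat_eq_zero_of_four_le hx])

theorem LPF.chiS_apply (ξ : V) : χ.chiS ξ = χ.chi ξ := rfl
theorem LPF.phiS_apply (ξ : V) : χ.phiS ξ = χ.phiHat ξ := rfl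
theorem LPF.chiWide_apply (ξ : V) : χ.chiWide ξ = χ.chi ((4 : ℝ)⁻¹ • ξ) := rfl

theorem LPF.chiWide_mul_phiS (ξ : V) : χ.chiWide ξ * χ.phiS ξ = χ.phiS ξ := by
  rw [LPF.chiWide_apply, LPF.phiS_apply]
  by_cases h : 4 ≤ ‖ξ‖
  · simp [χ.phiHat_eq_zero_of_four_le h]
  · rw [χ.eq_one, Complex.ofReal_one, one_mul]
    rw [norm_smul, Real.norm_of_nonneg (by norm_num)]; linarith

theorem LPF.block_eq_op (k : ℤ) (f : 𝓢(V, ℂ)) : χ.block k f = op χ.phiS k f := by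
  have h : op χ.phiS k f = (𝓕⁻ (𝓕 (op χ.phiS k f) : 𝓢(V, ℂ)) : 𝓢(V, ℂ)) := by simp
  rw [h, fourierInv_coe, LPF.block]
  congr 1
  ext ξ
  rw [fourier_op, LPF.phiS_apply, fourier_coe]

theorem besov_eq (s p : ℝ) (f : 𝓢(V, ℂ)) :
    besov χ s p f = ∑' k : ℤ, ENNReal.ofReal ((2 : ℝ) ^ (s * (k : ℝ))) *
      eLpNorm (op χ.phiS k f) (ENNReal.ofReal p) volume := by
  simp only [besov, χ.block_eq_op]

theorem op_chiWide_op_phiS (k : ℤ) (f : 𝓢(V, ℂ)) :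
    op χ.chiWide k (op χ.phiS k f) = op χ.phiS k f := by
  apply ext_fourier
  intro ξ
  rw [fourier_op, fourier_op, ← mul_assoc, χ.chiWide_mul_phiS]

theorem op_chiS_succ (j : ℤ) (f : 𝓢(V, ℂ)) :
    op χ.chiS (j + 1) f = op χ.chiS j f + op χ.phiS j f := by
  apply ext_fourier
  intro ξ
  rw [FourierTransform.fourier_add, add_apply, fourier_op, fourier_op, fourier_op, LPF.phiS_apply,
    LPF.phiHat, LPF.chiS_apply, LPF.chiS_apply, smul_smul]
  have : (2 : ℝ)⁻¹ * 2 ^ (-j) = 2 ^ (-(j + 1)) := by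
    rw [neg_add, zpow_add₀ (by norm_num), mul_comm]; norm_num
  rw [this]
  push_cast
  ring

/-- Bernstein's inequality for Littlewood–Paley blocks. -/
theorem exists_enorm_block_le {p : ℝ} (hp : 1 < p) :
    ∃ C : ℝ≥0, ∀ (k : ℤ) (f : 𝓢(V, ℂ)) x, ‖op χ.phiS k f x‖ₑ ≤
      C * (ENNReal.ofReal ((2 : ℝ) ^ ((Module.finrank ℝ V : ℝ) / p * k)) *
        eLpNorm (op χ.phiS k f) (ENNReal.ofReal p) volume) := by
  obtain ⟨C, hC⟩ := exists_enorm_op_le χ.chiWide hp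
  refine ⟨C, fun k f x => ?_⟩
  have := hC k (op χ.phiS k f) x
  rwa [op_chiWide_op_phiS, mul_assoc] at this

theorem tendsto_op_chiS_atTop (f : 𝓢(V, ℂ)) (x : V) :
    Tendsto (fun n : ℕ => op χ.chiS n f x) atTop (𝓝 (f x)) := by
  have key : ∀ g : 𝓢(V, ℂ), g x = ∫ v, Real.fourierChar (inner ℝ v x) • (𝓕 g : 𝓢(V, ℂ)) v := by
    intro g
    have h : g = (𝓕⁻ (𝓕 g : 𝓢(V, ℂ)) : 𝓢(V, ℂ)) := by simp
    nth_rw 1 [h]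
    rw [fourierInv_coe, Real.fourierInv_eq]
  simp only [key f, key (op χ.chiS _ f)]
  refine tendsto_integral_of_dominated_convergence (fun v => ‖(𝓕 f : 𝓢(V, ℂ)) v‖) ?_
    (𝓕 f).integrable.norm ?_ ?_
  · intro n
    have h1 := (𝓕 (op χ.chiS n f) : 𝓢(V, ℂ)).continuous
    refine Continuous.aestronglyMeasurable ?_
    simp only [Circle.smul_def, smul_eq_mul]
    fun_prop
  · intro n
    refine Eventually.of_forall fun v => ?_
    rw [Circle.norm_smul, fourier_op, norm_mul, χ.chiS_apply, Complex.norm_real,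
      Real.norm_of_nonneg (χ.nonneg _)]
    refine mul_le_of_le_one_left (norm_nonneg _) ?_
    rw [← χ.eq_one (0 : V) (by simp)]
    exact χ.radial_antitone _ _ (by simp)
  · refine Eventually.of_forall fun v => tendsto_const_nhds.congr' ?_
    obtain ⟨n₀, hn₀⟩ := pow_unbounded_of_one_lt ‖v‖ (one_lt_two (α := ℝ))
    filter_upwards [eventually_ge_atTop n₀] with n hn
    rw [fourier_op, χ.chiS_apply, χ.eq_one, Complex.ofReal_one, one_mul]
    rw [norm_smul, Real.norm_of_nonneg (by positivity), zpow_neg, zpow_natCast,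
      inv_mul_le_one₀ (by positivity)]
    exact hn₀.le.trans (pow_le_pow_right₀ (by norm_num) hn)

theorem tendsto_op_chiS_neg [Nontrivial V] (f : 𝓢(V, ℂ)) (x : V) :
    Tendsto (fun n : ℕ => op χ.chiS (-n) f x) atTop (𝓝 0) := by
  obtain ⟨C, hC⟩ := exists_enorm_op_le χ.chiS (p := 2) (by norm_num)
  have hd : 0 < (Module.finrank ℝ V : ℝ) / 2 := by
    have : 0 < Module.finrank ℝ V := Module.finrank_pos
    positivity
  have h0 : Tendsto (fun n : ℕ => C * ENNReal.ofReal
      ((2 : ℝ) ^ ((Module.finrank ℝ V : ℝ) / 2 * ((-n : ℤ) : ℝ))) *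
        eLpNorm f (ENNReal.ofReal 2) volume) atTop (𝓝 0) := by
    have h1 : Tendsto (fun n : ℕ => (2 : ℝ) ^ ((Module.finrank ℝ V : ℝ) / 2 * ((-n : ℤ) : ℝ)))
        atTop (𝓝 0) := by
      have h2 := tendsto_pow_atTop_nhds_zero_of_lt_one
        (r := (2 : ℝ) ^ (-((Module.finrank ℝ V : ℝ) / 2))) (by positivity)
        (Real.rpow_lt_one_of_one_lt_of_neg (by norm_num) (by linarith))
      refine h2.congr fun n => ?_
      rw [← Real.rpow_natCast, ← Real.rpow_mul (by norm_num)]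
      congr 1; push_cast; ring
    have h3 := ENNReal.tendsto_ofReal h1
    rw [ENNReal.ofReal_zero] at h3
    have h4 := ENNReal.Tendsto.const_mul (a := (C : ℝ≥0∞)) h3 (Or.inr ENNReal.coe_ne_top)
    rw [mul_zero] at h4
    have h5 := ENNReal.Tendsto.mul_const (b := eLpNorm f (ENNReal.ofReal 2) volume) h4
      (Or.inr (f.eLpNorm_lt_top _ volume).ne)
    rwa [zero_mul] at h5
  rw [tendsto_zero_iff_enorm_tendsto_zero]
  refine tendsto_of_tendsto_of_tendsto_of_le_of_le tendsto_const_nhds h0 (fun _ => zero_le) ?_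
  intro n
  exact hC (-n) f x

/-- The embedding of `Ḃ^{d/p}_{p,1}` into `L^∞`. -/
theorem exists_enorm_le_besov [Nontrivial V] {p : ℝ} (hp : 1 < p) :
    ∃ C : ℝ≥0, ∀ (f : 𝓢(V, ℂ)) x,
      ‖f x‖ₑ ≤ C * besov χ ((Module.finrank ℝ V : ℝ) / p) p f := by
  obtain ⟨C, hC⟩ := exists_enorm_block_le χ hp
  refine ⟨C, fun f x => ?_⟩
  have hlim : Tendsto (fun n : ℕ => ‖op χ.chiS n f x - op χ.chiS (-n) f x‖ₑ) atTop
      (𝓝 ‖f x‖ₑ) := by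
    have := ((tendsto_op_chiS_atTop χ f x).sub (tendsto_op_chiS_neg χ f x)).enorm
    simpa using this
  refine le_of_tendsto' hlim fun n => ?_
  have htel : ∀ m : ℤ, -n ≤ m → op χ.chiS m f x - op χ.chiS (-n) f x =
      ∑ j ∈ Finset.Ico (-n : ℤ) m, op χ.phiS j f x := by
    intro m hm
    induction m, hm using Int.leInduction with
    | base => simp
    | succ m hm ih =>
      rw [sum_Ico_int_succ _ hm, ← ih, op_chiS_succ, add_apply]
      ring
  rw [htel n (by omega), besov_eq, ← ENNReal.tsum_mul_left]
  refine (enorm_sum_le _ _).trans ((Finset.sum_le_sum fun j _ => hC j f x).trans ?_)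
  exact ENNReal.sum_le_tsum _

end LittlewoodPaley

section Algebra

variable {V : Type*} [NormedAddCommGroup V] [InnerProductSpace ℝ V]
    [FiniteDimensional ℝ V] [MeasurableSpace V] [BorelSpace V] (χ : LPF V)

theorem fourier_op_chiS_eq_zero (j : ℤ) (f : 𝓢(V, ℂ)) {ζ : V} (h : 2 * (2 : ℝ) ^ j ≤ ‖ζ‖) :
    𝓕 (op χ.chiS j f) ζ = 0 := by
  rw [fourier_op, χ.chiS_apply, χ.supp, Complex.ofReal_zero, zero_mul]
  rw [norm_smul, Real.norm_of_nonneg (by positivity), zpow_neg, ← div_eq_inv_mul,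
    le_div_iff₀ (by positivity)]
  exact h

theorem op_phiS_pmul_eq_zero {k n : ℤ} (h : n + 2 ≤ k) (f g : 𝓢(V, ℂ)) :
    op χ.phiS k (pmul (op χ.chiS n f) (op χ.chiS n g)) = 0 := by
  apply ext_fourier
  intro ξ
  rw [fourier_op]
  by_cases hξ : ‖(2 : ℝ) ^ (-k) • ξ‖ ≤ 1
  · rw [χ.phiS_apply, χ.phiHat_eq_zero_of_le_one hξ]
    simp
  · rw [fourier_pmul_eq_zero (fun ζ => fourier_op_chiS_eq_zero χ n f)
      (fun ζ => fourier_op_chiS_eq_zero χ n g)]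
    · simp
    · rw [norm_smul, Real.norm_of_nonneg (by positivity), zpow_neg, ← div_eq_inv_mul, not_le,
        one_lt_div (by positivity)] at hξ
      refine le_trans ?_ hξ.le
      calc 2 * (2 * (2 : ℝ) ^ n) = 2 ^ (n + 2) := by
            rw [zpow_add₀ (by norm_num)]; norm_num; ring
        _ ≤ _ := zpow_le_zpow_right₀ (by norm_num) h

theorem eLpNorm_add_le_ofReal {p : ℝ} (hp : 1 < p) (f g : 𝓢(V, ℂ)) :
    eLpNorm (f + g : 𝓢(V, ℂ)) (ENNReal.ofReal p) volume ≤
      eLpNorm f (ENNReal.ofReal p) volume + eLpNorm g (ENNReal.ofReal p) volume :=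
  eLpNorm_add_le f.continuous.aestronglyMeasurable g.continuous.aestronglyMeasurable
    (by rw [← ENNReal.ofReal_one]; exact ENNReal.ofReal_le_ofReal hp.le)

theorem exists_eLpNorm_block_pmul_succ_le {p : ℝ} (hp : 1 < p) :
    ∃ C : ℝ≥0, ∀ (k j : ℤ) (f g : 𝓢(V, ℂ)) (Mf Mg : ℝ≥0∞), (∀ x, ‖f x‖ₑ ≤ Mf) →
      (∀ x, ‖g x‖ₑ ≤ Mg) →
      eLpNorm (op χ.phiS k (pmul (op χ.chiS (j + 1) f) (op χ.chiS (j + 1) g)))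
          (ENNReal.ofReal p) volume ≤
        eLpNorm (op χ.phiS k (pmul (op χ.chiS j f) (op χ.chiS j g))) (ENNReal.ofReal p) volume +
        C * (Mf * eLpNorm (op χ.phiS j g) (ENNReal.ofReal p) volume +
          Mg * eLpNorm (op χ.phiS j f) (ENNReal.ofReal p) volume) := by
  obtain ⟨C, hC⟩ := exists_eLpNorm_op_le χ.phiS hp
  have hfin : eLpNorm (invF χ.chiS) 1 volume ≠ ∞ := ((invF χ.chiS).eLpNorm_lt_top _ volume).ne
  refine ⟨C * (eLpNorm (invF χ.chiS) 1 volume).toNNReal, fun k j f g Mf Mg hf hg => ?_⟩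
  rw [ENNReal.coe_mul, ENNReal.coe_toNNReal hfin]
  set A := eLpNorm (invF χ.chiS) 1 volume
  have hdecomp : pmul (op χ.chiS (j + 1) f) (op χ.chiS (j + 1) g) =
      pmul (op χ.chiS j f) (op χ.chiS j g) + (pmul (op χ.chiS j f) (op χ.phiS j g) +
        pmul (op χ.chiS (j + 1) g) (op χ.phiS j f)) := by
    rw [op_chiS_succ, op_chiS_succ]
    ext x
    simp only [pmul_apply, add_apply]
    ring
  rw [hdecomp, op_add]
  refine (eLpNorm_add_le_ofReal hp _ _).trans (add_le_add le_rfl ?_)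
  refine (hC k _).trans ?_
  rw [mul_assoc]
  refine mul_le_mul' le_rfl ((eLpNorm_add_le_ofReal hp _ _).trans ?_)
  rw [mul_add, ← mul_assoc, ← mul_assoc]
  exact add_le_add (eLpNorm_pmul_le (by linarith) _ _ fun x => enorm_op_le _ _ _ hf x)
    (eLpNorm_pmul_le (by linarith) _ _ fun x => enorm_op_le _ _ _ hg x)

theorem tendsto_op_pmul_chiS (m : 𝓢(V, ℂ)) (k : ℤ) (f g : 𝓢(V, ℂ)) (x : V) :
    Tendsto (fun n : ℕ => op m k (pmul (op χ.chiS n f) (op χ.chiS n g)) x) atTop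
      (𝓝 (op m k (pmul f g) x)) := by
  have bdd : ∀ h : 𝓢(V, ℂ), ∃ M : ℝ, 0 ≤ M ∧ ∀ (n : ℕ) y, ‖op χ.chiS n h y‖ ≤ M := by
    intro h
    obtain ⟨M, hM⟩ : ∃ M : ℝ≥0, ∀ y, ‖h y‖ₑ ≤ M := by
      refine ⟨(SchwartzMap.seminorm ℝ 0 0 h).toNNReal, fun y => ?_⟩
      rw [← ofReal_norm, ENNReal.ofReal]
      exact_mod_cast Real.toNNReal_le_toNNReal (h.norm_le_seminorm ℝ y)
    have hfin : eLpNorm (invF χ.chiS) 1 volume * M ≠ ∞ :=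
      ENNReal.mul_ne_top ((invF χ.chiS).eLpNorm_lt_top _ volume).ne ENNReal.coe_ne_top
    refine ⟨(eLpNorm (invF χ.chiS) 1 volume * M).toReal, ENNReal.toReal_nonneg, fun n y => ?_⟩
    rw [← toReal_enorm]
    exact ENNReal.toReal_mono hfin (enorm_op_le _ _ _ hM y)
  obtain ⟨Mf, hMf, hf⟩ := bdd f
  obtain ⟨Mg, hMg, hg⟩ := bdd g
  simp only [op_apply]
  refine tendsto_integral_of_dominated_convergence (fun y => ‖invF (dil m k) y‖ * (Mf * Mg)) ?_
    ((invF (dil m k)).integrable.norm.mul_const _) ?_ ?_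
  · intro n
    refine Continuous.aestronglyMeasurable ?_
    have := (pmul (op χ.chiS n f) (op χ.chiS n g)).continuous
    have := (invF (dil m k)).continuous
    fun_prop
  · intro n
    refine Eventually.of_forall fun y => ?_
    rw [norm_mul, pmul_apply, norm_mul]
    gcongr
    exacts [hf _ _, hg _ _]
  · refine Eventually.of_forall fun y => Tendsto.const_mul _ ?_
    simp only [pmul_apply]
    exact (tendsto_op_chiS_atTop χ f _).mul (tendsto_op_chiS_atTop χ g _)

theorem exists_eLpNorm_block_pmul_le {p : ℝ} (hp : 1 < p) :
    ∃ C : ℝ≥0, ∀ (k : ℤ) (f g : 𝓢(V, ℂ)) (Mf Mg : ℝ≥0∞), (∀ x, ‖f x‖ₑ ≤ Mf) →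
      (∀ x, ‖g x‖ₑ ≤ Mg) →
      eLpNorm (op χ.phiS k (pmul f g)) (ENNReal.ofReal p) volume ≤
        ∑' i : ℕ, C * (Mf * eLpNorm (op χ.phiS (k - 2 + i) g) (ENNReal.ofReal p) volume +
          Mg * eLpNorm (op χ.phiS (k - 2 + i) f) (ENNReal.ofReal p) volume) := by
  obtain ⟨C, hC⟩ := exists_eLpNorm_block_pmul_succ_le χ hp
  refine ⟨C, fun k f g Mf Mg hf hg => ?_⟩
  set a : ℤ → ℝ≥0∞ := fun j => C * (Mf * eLpNorm (op χ.phiS j g) (ENNReal.ofReal p) volume +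
          Mg * eLpNorm (op χ.phiS j f) (ENNReal.ofReal p) volume) with ha
  have h1 : ∀ m : ℕ, eLpNorm (op χ.phiS k (pmul (op χ.chiS (k - 2 + m) f)
      (op χ.chiS (k - 2 + m) g))) (ENNReal.ofReal p) volume ≤
        ∑ i ∈ Finset.range m, a (k - 2 + i) := by
    intro m
    induction m with
    | zero =>
      rw [op_phiS_pmul_eq_zero χ (by simp)]
      simp
    | succ m ih =>
      rw [Finset.sum_range_succ]
      refine le_trans ?_ (add_le_add ih le_rfl)
      have := hC k (k - 2 + m) f g Mf Mg hf hg
      rwa [add_assoc, ← Nat.cast_succ] at this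
  have h2 : ∀ n : ℕ, eLpNorm (op χ.phiS k (pmul (op χ.chiS n f) (op χ.chiS n g)))
      (ENNReal.ofReal p) volume ≤ ∑' i : ℕ, a (k - 2 + i) := by
    intro n
    by_cases h : (n : ℤ) + 2 ≤ k
    · rw [op_phiS_pmul_eq_zero χ h]
      simp
    · obtain ⟨m, hm⟩ := Int.eq_ofNat_of_zero_le (a := n - (k - 2)) (by omega)
      rw [show (n : ℤ) = k - 2 + m by omega]
      exact (h1 m).trans (ENNReal.sum_le_tsum _)
  refine (Lp.eLpNorm_lim_le_liminf_eLpNorm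
    (f := fun n : ℕ => (op χ.phiS k (pmul (op χ.chiS n f) (op χ.chiS n g)) : V → ℂ))
    (fun n => (SchwartzMap.continuous _).aestronglyMeasurable) _
    (Eventually.of_forall fun x => tendsto_op_pmul_chiS χ _ k f g x)).trans ?_
  exact liminf_le_of_le (by isBoundedDefault) fun b hb => by
    obtain ⟨n, hn⟩ := hb.exists
    exact hn.trans (h2 n)

theorem tsum_weight_shift {s : ℝ} (b : ℤ → ℝ≥0∞) (i : ℕ) :
    ∑' k : ℤ, ENNReal.ofReal ((2 : ℝ) ^ (s * (k : ℝ))) * b (k - 2 + i) =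
      ENNReal.ofReal ((2 : ℝ) ^ (s * 2)) * ENNReal.ofReal ((2 : ℝ) ^ (-s)) ^ i *
        ∑' j : ℤ, ENNReal.ofReal ((2 : ℝ) ^ (s * (j : ℝ))) * b j := by
  rw [← ENNReal.tsum_mul_left, ← (Equiv.addRight (2 - i : ℤ)).tsum_eq]
  refine tsum_congr fun j => ?_
  rw [← ENNReal.ofReal_pow (by positivity), ← ENNReal.ofReal_mul (by positivity), ← mul_assoc,
    ← ENNReal.ofReal_mul (by positivity), ← Real.rpow_natCast, ← Real.rpow_mul (by norm_num),
    ← Real.rpow_add (by norm_num), ← Real.rpow_add (by norm_num)]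
  simp only [Equiv.coe_addRight]
  congr 2
  · push_cast; ring_nf
  · ring_nf

/-- The homogeneous Besov space `Ḃ^{d/p}_{p,1}` is an algebra. -/
theorem exists_besov_pmul_le [Nontrivial V] {p : ℝ} (hp : 1 < p) :
    ∃ C : ℝ≥0, ∀ f g : 𝓢(V, ℂ),
      besov χ ((Module.finrank ℝ V : ℝ) / p) p (pmul f g) ≤
        C * (besov χ ((Module.finrank ℝ V : ℝ) / p) p f *
          besov χ ((Module.finrank ℝ V : ℝ) / p) p g) := by
  obtain ⟨C, hC⟩ := exists_eLpNorm_block_pmul_le χ hp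
  obtain ⟨K, hK⟩ := exists_enorm_le_besov χ hp
  have hs : 0 < (Module.finrank ℝ V : ℝ) / p := by
    have : 0 < Module.finrank ℝ V := Module.finrank_pos
    positivity
  set s := (Module.finrank ℝ V : ℝ) / p
  set G : ℝ≥0∞ := ∑' i : ℕ, ENNReal.ofReal ((2 : ℝ) ^ (s * 2)) * ENNReal.ofReal ((2 : ℝ) ^ (-s)) ^ i
    with hGdef
  have hG : G ≠ ∞ := by
    rw [hGdef, ENNReal.tsum_mul_left, ENNReal.tsum_geometric]
    refine ENNReal.mul_ne_top ENNReal.ofReal_ne_top (ENNReal.inv_ne_top.2 ?_)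
    rw [Ne, tsub_eq_zero_iff_le, not_le]
    rw [ENNReal.ofReal_lt_one]
    exact Real.rpow_lt_one_of_one_lt_of_neg (by norm_num) (by linarith)
  refine ⟨G.toNNReal * (C * (2 * K)), fun f g => ?_⟩
  set b : ℤ → ℝ≥0∞ := fun j => C * (K * besov χ s p f *
    eLpNorm (op χ.phiS j g) (ENNReal.ofReal p) volume +
          K * besov χ s p g * eLpNorm (op χ.phiS j f) (ENNReal.ofReal p) volume) with hb
  have hsum : ∑' j : ℤ, ENNReal.ofReal ((2 : ℝ) ^ (s * (j : ℝ))) * b j =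
      C * (2 * K) * (besov χ s p f * besov χ s p g) := by
    have h1 : ∀ j : ℤ, ENNReal.ofReal ((2 : ℝ) ^ (s * (j : ℝ))) * b j =
        C * (K * besov χ s p f) * (ENNReal.ofReal ((2 : ℝ) ^ (s * (j : ℝ))) *
          eLpNorm (op χ.phiS j g) (ENNReal.ofReal p) volume) +
        C * (K * besov χ s p g) * (ENNReal.ofReal ((2 : ℝ) ^ (s * (j : ℝ))) *
          eLpNorm (op χ.phiS j f) (ENNReal.ofReal p) volume) := fun j => by
      simp only [hb]; ring
    rw [tsum_congr h1, ENNReal.tsum_add, ENNReal.tsum_mul_left, ENNReal.tsum_mul_left,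
      ← besov_eq, ← besov_eq]
    ring
  calc besov χ s p (pmul f g)
      ≤ ∑' k : ℤ, ENNReal.ofReal ((2 : ℝ) ^ (s * (k : ℝ))) * ∑' i : ℕ, b (k - 2 + i) := by
        rw [besov_eq]
        gcongr with k
        exact hC k f g _ _ (hK f) (hK g)
    _ = ∑' i : ℕ, ∑' k : ℤ, ENNReal.ofReal ((2 : ℝ) ^ (s * (k : ℝ))) * b (k - 2 + i) := by
        simp_rw [← ENNReal.tsum_mul_left]
        rw [ENNReal.tsum_comm]
    _ = G * ∑' j : ℤ, ENNReal.ofReal ((2 : ℝ) ^ (s * (j : ℝ))) * b j := by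
        simp_rw [tsum_weight_shift]
        rw [ENNReal.tsum_mul_right]
    _ = _ := by
        rw [hsum]
        push_cast
        rw [ENNReal.coe_toNNReal hG]
        ring

end Algebra

section Derivatives

open LineDeriv

variable {V : Type*} [NormedAddCommGroup V] [InnerProductSpace ℝ V]
    [FiniteDimensional ℝ V] [MeasurableSpace V] [BorelSpace V] (χ : LPF V)

theorem fourier_lineDeriv_apply (e : V) (f : 𝓢(V, ℂ)) (ξ : V) :
    𝓕 (∂_{e} f : 𝓢(V, ℂ)) ξ = 2 * Real.pi * Complex.I * (inner ℝ ξ e : ℝ) * 𝓕 f ξ := by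
  rw [fourier_lineDerivOp_eq, smul_apply,
    SchwartzMap.smulLeftCLM_apply_apply (by fun_prop)]
  rw [smul_eq_mul, Complex.real_smul]
  ring

theorem LPF.chi_div_four_eq_zero {ξ : V} (h : 8 ≤ ‖ξ‖) : χ.chi ((4 : ℝ)⁻¹ • ξ) = 0 := by
  rw [χ.supp]
  rw [norm_smul, Real.norm_of_nonneg (by norm_num)]; linarith

/-- The symbol of `∂_e`, localized to low frequencies. -/
def LPF.derivSymbol (e : V) : 𝓢(V, ℂ) :=
  ofCpt (fun ξ => 2 * Real.pi * Complex.I * (inner ℝ ξ e : ℝ) * (χ.chi ((4 : ℝ)⁻¹ • ξ) : ℝ)) 8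
    ((contDiff_const.mul (Complex.ofRealCLM.contDiff.comp (contDiff_id.inner ℝ contDiff_const))).mul
      (χ.contDiff_comp_smul _))
    (fun ξ h => by simp [χ.chi_div_four_eq_zero h])

theorem LPF.norm_sq_add_chi_pos (ξ : V) : 0 < ‖ξ‖ ^ 2 + χ.chi ((2 : ℝ) • ξ) := by
  by_cases h : ξ = 0
  · rw [h, smul_zero, χ.eq_one 0 (by simp)]
    simp
  · have := χ.nonneg ((2 : ℝ) • ξ)
    have := norm_pos_iff.2 h
    positivity

/-- The symbol of `∂_e Δ⁻¹`, localized to an annulus. -/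
def LPF.antiderivSymbol (e : V) : 𝓢(V, ℂ) :=
  ofCpt (fun ξ => (2 * Real.pi * Complex.I)⁻¹ * ((inner ℝ ξ e * χ.chi ((4 : ℝ)⁻¹ • ξ) /
      (‖ξ‖ ^ 2 + χ.chi ((2 : ℝ) • ξ)) : ℝ) : ℂ)) 8
    (contDiff_const.mul (Complex.ofRealCLM.contDiff.comp
      (((contDiff_id.inner ℝ contDiff_const).mul (χ.smooth.comp (contDiff_const_smul _))).div
        ((contDiff_norm_sq ℝ).add (χ.smooth.comp (contDiff_const_smul _)))
        fun ξ => (χ.norm_sq_add_chi_pos ξ).ne')))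
    (fun ξ h => by simp [χ.chi_div_four_eq_zero h])

theorem LPF.derivSymbol_apply (e ξ : V) : χ.derivSymbol e ξ =
    2 * Real.pi * Complex.I * (inner ℝ ξ e : ℝ) * (χ.chi ((4 : ℝ)⁻¹ • ξ) : ℝ) := rfl

theorem LPF.antiderivSymbol_apply (e ξ : V) : χ.antiderivSymbol e ξ =
    (2 * Real.pi * Complex.I)⁻¹ * ((inner ℝ ξ e * χ.chi ((4 : ℝ)⁻¹ • ξ) /
      (‖ξ‖ ^ 2 + χ.chi ((2 : ℝ) • ξ)) : ℝ) : ℂ) := rfl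

theorem op_phiS_lineDeriv (e : V) (k : ℤ) (f : 𝓢(V, ℂ)) :
    op χ.phiS k (∂_{e} f : 𝓢(V, ℂ)) =
      ((2 : ℝ) ^ k : ℝ) • op (χ.derivSymbol e) k (op χ.phiS k f) := by
  apply ext_fourier
  intro ξ
  have h := χ.chiWide_mul_phiS ((2 : ℝ) ^ (-k) • ξ)
  rw [χ.chiWide_apply] at h
  rw [FourierTransform.fourier_smul, smul_apply, fourier_op, fourier_op, fourier_op,
    fourier_lineDeriv_apply,
    χ.derivSymbol_apply, Complex.real_smul, real_inner_smul_left]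
  have h2 : (((2 : ℝ) ^ k : ℝ) : ℂ) * (((2 : ℝ) ^ (-k) : ℝ) : ℂ) = 1 := by
    rw [← Complex.ofReal_mul, ← zpow_add₀ (by norm_num)]; simp
  rw [Complex.ofReal_mul]
  linear_combination (2 * Real.pi * Complex.I * (inner ℝ ξ e : ℝ) * 𝓕 f ξ) *
    (-χ.phiS ((2 : ℝ) ^ (-k) • ξ) * h2 -
      (((2 : ℝ) ^ k : ℝ) : ℂ) * (((2 : ℝ) ^ (-k) : ℝ) : ℂ) * h)

theorem LPF.sum_antiderivSymbol_mul {ι : Type*} [Fintype ι] (b : OrthonormalBasis ι ℝ V) (ξ : V) :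
    ∑ i, χ.antiderivSymbol (b i) ξ * (2 * Real.pi * Complex.I * (inner ℝ ξ (b i) : ℝ)) * χ.phiS ξ =
      χ.phiS ξ := by
  by_cases h : ‖ξ‖ ≤ 1
  · simp [χ.phiS_apply, χ.phiHat_eq_zero_of_le_one h]
  have h1 : χ.chi ((2 : ℝ) • ξ) = 0 := by
    rw [χ.supp]
    rw [norm_smul, Real.norm_of_nonneg (by norm_num)]; linarith
  have h2 := χ.chiWide_mul_phiS ξ
  rw [χ.chiWide_apply] at h2
  have h3 : ∑ i, inner ℝ ξ (b i) * inner ℝ ξ (b i) = ‖ξ‖ ^ 2 := by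
    rw [← b.sum_sq_norm_inner_left ξ]
    refine Finset.sum_congr rfl fun i _ => ?_
    rw [Real.norm_eq_abs, sq_abs, sq]
  have h4 : ((‖ξ‖ ^ 2 : ℝ) : ℂ) ≠ 0 := by
    have : 0 < ‖ξ‖ := by linarith
    exact_mod_cast (by positivity : ‖ξ‖ ^ 2 ≠ 0)
  have h5 : (2 * Real.pi * Complex.I : ℂ) ≠ 0 := by simp [Real.pi_ne_zero]
  calc _ = ∑ i, ((inner ℝ ξ (b i) * inner ℝ ξ (b i) : ℝ) : ℂ) * (((‖ξ‖ ^ 2 : ℝ) : ℂ)⁻¹ *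
        (((χ.chi ((4 : ℝ)⁻¹ • ξ) : ℝ) : ℂ) * χ.phiS ξ)) := by
        refine Finset.sum_congr rfl fun i _ => ?_
        rw [χ.antiderivSymbol_apply, h1, add_zero]
        push_cast
        field_simp
    _ = _ := by
        rw [← Finset.sum_mul, ← Complex.ofReal_sum, h3, h2, ← mul_assoc, mul_inv_cancel₀ h4,
          one_mul]

theorem fourier_sum {ι : Type*} (S : Finset ι) (f : ι → 𝓢(V, ℂ)) (ξ : V) :
    𝓕 (∑ i ∈ S, f i) ξ = ∑ i ∈ S, 𝓕 (f i) ξ := by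
  classical
  induction S using Finset.induction_on with
  | empty => simp
  | insert a S ha ih =>
    rw [Finset.sum_insert ha, Finset.sum_insert ha, FourierTransform.fourier_add, add_apply, ih]

theorem op_phiS_eq_sum {ι : Type*} [Fintype ι] (b : OrthonormalBasis ι ℝ V) (k : ℤ)
    (f : 𝓢(V, ℂ)) : op χ.phiS k f = ((2 : ℝ) ^ (-k) : ℝ) •
      ∑ i, op (χ.antiderivSymbol (b i)) k (op χ.phiS k (∂_{b i} f : 𝓢(V, ℂ))) := by
  apply ext_fourier
  intro ξ
  rw [FourierTransform.fourier_smul, smul_apply, fourier_sum, fourier_op,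
    ← χ.sum_antiderivSymbol_mul b, Complex.real_smul, Finset.sum_mul, Finset.mul_sum]
  refine Finset.sum_congr rfl fun i _ => ?_
  rw [fourier_op, fourier_op, fourier_lineDeriv_apply, real_inner_smul_left, Complex.ofReal_mul]
  ring

theorem eLpNorm_real_smul (c : ℝ) (hc : 0 ≤ c) (q : ℝ≥0∞) (f : 𝓢(V, ℂ)) :
    eLpNorm (c • f : 𝓢(V, ℂ)) q volume = ENNReal.ofReal c * eLpNorm f q volume := by
  have : ((c • f : 𝓢(V, ℂ)) : V → ℂ) = c • (f : V → ℂ) := rfl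
  rw [this, eLpNorm_const_smul, Real.enorm_of_nonneg hc]

theorem ofReal_two_rpow_mul_zpow (a b : ℝ) (k m : ℤ) (h : a * k + m = b * k) :
    ENNReal.ofReal ((2 : ℝ) ^ (a * (k : ℝ))) * ENNReal.ofReal ((2 : ℝ) ^ m) =
      ENNReal.ofReal ((2 : ℝ) ^ (b * (k : ℝ))) := by
  rw [← ENNReal.ofReal_mul (by positivity), ← Real.rpow_intCast, ← Real.rpow_add (by norm_num), h]

theorem exists_besov_lineDeriv_le {p : ℝ} (hp : 1 < p) (s : ℝ) (e : V) :
    ∃ C : ℝ≥0, ∀ f : 𝓢(V, ℂ),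
      besov χ (-1 + s) p (∂_{e} f : 𝓢(V, ℂ)) ≤ C * besov χ s p f := by
  obtain ⟨C, hC⟩ := exists_eLpNorm_op_le (χ.derivSymbol e) hp
  refine ⟨C, fun f => ?_⟩
  rw [besov_eq, besov_eq, ← ENNReal.tsum_mul_left]
  refine ENNReal.tsum_le_tsum fun k => ?_
  rw [op_phiS_lineDeriv, eLpNorm_real_smul _ (by positivity), ← mul_assoc,
    ofReal_two_rpow_mul_zpow _ s k k (by ring), mul_left_comm]
  exact mul_le_mul' le_rfl (hC k _)

theorem exists_besov_le_sum_lineDeriv {ι : Type*} [Fintype ι] (b : OrthonormalBasis ι ℝ V) {p : ℝ}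
    (hp : 1 < p) (s : ℝ) : ∃ C : ℝ≥0, ∀ f : 𝓢(V, ℂ),
      besov χ s p f ≤ C * ∑ i, besov χ (-1 + s) p (∂_{b i} f : 𝓢(V, ℂ)) := by
  choose C hC using fun i => exists_eLpNorm_op_le (χ.antiderivSymbol (b i)) hp
  refine ⟨∑ i, C i, fun f => ?_⟩
  simp only [besov_eq]
  rw [← Summable.tsum_finsetSum (fun _ _ => ENNReal.summable), ← ENNReal.tsum_mul_left]
  refine ENNReal.tsum_le_tsum fun k => ?_
  rw [op_phiS_eq_sum χ b k f, eLpNorm_real_smul _ (by positivity), ← mul_assoc,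
    ofReal_two_rpow_mul_zpow _ (-1 + s) k (-k) (by push_cast; ring), ← Finset.mul_sum,
    mul_left_comm]
  refine mul_le_mul' le_rfl ?_
  have hcoe : ((∑ i, op (χ.antiderivSymbol (b i)) k (op χ.phiS k (∂_{b i} f : 𝓢(V, ℂ))) :
      𝓢(V, ℂ)) : V → ℂ) =
      ∑ i, (op (χ.antiderivSymbol (b i)) k (op χ.phiS k (∂_{b i} f : 𝓢(V, ℂ))) : V → ℂ) := by
    ext x
    simp
  rw [hcoe]
  refine (eLpNorm_sum_le (fun i _ => (SchwartzMap.continuous _).aestronglyMeasurable)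
    (by rw [← ENNReal.ofReal_one]; exact ENNReal.ofReal_le_ofReal hp.le)).trans ?_
  rw [Finset.mul_sum]
  refine Finset.sum_le_sum fun i _ => (hC i k _).trans (mul_le_mul' ?_ le_rfl)
  exact_mod_cast Finset.single_le_sum (f := C) (fun _ _ => zero_le) (Finset.mem_univ i)

end Derivatives

section TimeIntegral

variable {V : Type*} [NormedAddCommGroup V] [InnerProductSpace ℝ V]
    [FiniteDimensional ℝ V] [MeasurableSpace V] [BorelSpace V] (χ : LPF V)

theorem measurable_op_uncurry (m : 𝓢(V, ℂ)) (k : ℤ) {w : ℝ → 𝓢(V, ℂ)}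
    (hw : Continuous fun q : ℝ × V => w q.1 q.2) :
    Measurable fun q : V × ℝ => op m k (w q.2) q.1 := by
  simp only [op_apply]
  have h1 := (invF (dil m k)).continuous
  have h2 : Continuous fun q : (V × ℝ) × V => invF (dil m k) q.2 * w q.1.2 (q.1.1 - q.2) :=
    (h1.comp continuous_snd).mul
      (hw.comp (g := fun q : ℝ × V => w q.1 q.2)
        (f := fun q : (V × ℝ) × V => (q.1.2, q.1.1 - q.2)) (by fun_prop))
  exact (StronglyMeasurable.integral_prod_right' (ν := volume) h2.stronglyMeasurable).measurable

theorem measurable_eLpNorm_op (m : 𝓢(V, ℂ)) (k : ℤ) {p : ℝ} (hp : 0 < p) {w : ℝ → 𝓢(V, ℂ)}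
    (hw : Continuous fun q : ℝ × V => w q.1 q.2) :
    Measurable fun τ => eLpNorm (op m k (w τ)) (ENNReal.ofReal p) volume := by
  simp only [eLpNorm_ofReal_eq hp]
  exact (((measurable_op_uncurry m k hw).enorm.pow_const p).lintegral_prod_left' (μ := volume)
    ).pow_const _

theorem measurable_besov {s p : ℝ} (hp : 0 < p) {w : ℝ → 𝓢(V, ℂ)}
    (hw : Continuous fun q : ℝ × V => w q.1 q.2) : Measurable fun τ => besov χ s p (w τ) := by
  simp only [besov_eq]
  exact Measurable.tsum fun k => (measurable_eLpNorm_op _ k hp hw).const_mul _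

theorem enorm_op_intervalIntegral_le (m : 𝓢(V, ℂ)) (k : ℤ) {w : ℝ → 𝓢(V, ℂ)}
    (hw : Continuous fun q : ℝ × V => w q.1 q.2)
    (hc : HasCompactSupport fun q : ℝ × V => w q.1 q.2) {t : ℝ} (ht : 0 ≤ t) {g : 𝓢(V, ℂ)}
    (hg : ∀ x, g x = ∫ τ in (0 : ℝ)..t, w τ x) (x : V) :
    ‖op m k g x‖ₑ ≤ ∫⁻ τ in Set.Ioc 0 t, ‖op m k (w τ) x‖ₑ := by
  obtain ⟨M, hM⟩ := hc.exists_bound_of_continuous hw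
  have hbd : Integrable (Function.uncurry fun (y : V) (τ : ℝ) =>
      invF (dil m k) y * w τ (x - y)) (volume.prod (volume.restrict (Set.Ioc 0 t))) := by
    have h1 : Integrable (fun q : V × ℝ => invF (dil m k) q.1 * (1 : ℂ))
        (volume.prod (volume.restrict (Set.Ioc 0 t))) :=
      (invF (dil m k)).integrable.mul_prod (integrable_const _)
    have h2 : Continuous fun q : V × ℝ => w q.2 (x - q.1) :=
      hw.comp (g := fun q : ℝ × V => w q.1 q.2) (f := fun q : V × ℝ => (q.2, x - q.1))
        (by fun_prop)
    have h3 := h1.mul_bdd (c := M) h2.aestronglyMeasurable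
      (Eventually.of_forall fun q => hM (q.2, x - q.1))
    simpa [Function.uncurry_def] using h3
  have h : op m k g x = ∫ τ in Set.Ioc 0 t, op m k (w τ) x := by
    simp only [op_apply, hg, intervalIntegral.integral_of_le ht]
    rw [← integral_integral_swap hbd]
    simp only [integral_const_mul]
  rw [h]
  exact enorm_integral_le_lintegral_enorm _

theorem besov_intervalIntegral_le {s p : ℝ} (hp : 1 < p) {w : ℝ → 𝓢(V, ℂ)}
    (hw : Continuous fun q : ℝ × V => w q.1 q.2)
    (hc : HasCompactSupport fun q : ℝ × V => w q.1 q.2) {t : ℝ} (ht : 0 ≤ t) {g : 𝓢(V, ℂ)}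
    (hg : ∀ x, g x = ∫ τ in (0 : ℝ)..t, w τ x) :
    besov χ s p g ≤ ∫⁻ τ in Set.Ioi 0, besov χ s p (w τ) := by
  refine le_trans ?_ (lintegral_mono_set Set.Ioc_subset_Ioi_self (t := Set.Ioi (0 : ℝ))
    (s := Set.Ioc 0 t))
  simp only [besov_eq]
  rw [lintegral_tsum fun k =>
    ((measurable_eLpNorm_op _ k (by linarith) hw).const_mul _).aemeasurable]
  refine ENNReal.tsum_le_tsum fun k => ?_
  rw [lintegral_const_mul _ (measurable_eLpNorm_op _ k (by linarith) hw)]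
  refine mul_le_mul' le_rfl ?_
  exact eLpNorm_le_lintegral_eLpNorm (F := fun x τ => op χ.phiS k (w τ) x) hp
    (SchwartzMap.continuous _).measurable (measurable_op_uncurry _ k hw)
    (enorm_op_intervalIntegral_le _ k hw hc ht hg) (SchwartzMap.eLpNorm_lt_top _ _ volume).ne

theorem contDiff_intervalIntegral {w : ℝ → V → ℝ}
    (hw : ContDiff ℝ (⊤ : ℕ∞) (Function.uncurry w)) (hc : HasCompactSupport (Function.uncurry w))
    {t : ℝ} (ht : 0 ≤ t) : ContDiff ℝ (⊤ : ℕ∞) fun x => ∫ τ in (0 : ℝ)..t, w τ x := by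
  have hf : LocallyIntegrable ((Set.Ioc 0 t).indicator fun _ => (1 : ℝ)) volume :=
    ((integrable_indicator_iff measurableSet_Ioc).2
      (integrableOn_const (by simp))).locallyIntegrable
  set K : Set ℝ := (fun q : ℝ × V => -q.1) '' tsupport (Function.uncurry w)
  have hK : IsCompact K := hc.isCompact.image (by fun_prop)
  have h := contDiffOn_convolution_right_with_param (n := (⊤ : ℕ∞)) (μ := volume)
    (ContinuousLinearMap.mul ℝ ℝ)
    (f := (Set.Ioc 0 t).indicator fun _ => (1 : ℝ)) (g := fun (x : V) (τ : ℝ) => w (-τ) x)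
    (s := Set.univ) isOpen_univ hK
    (fun x τ _ hτ => by
      by_contra h0
      exact hτ ⟨(-τ, x), subset_tsupport _ h0, by simp⟩) hf
    ((hw.comp (g := Function.uncurry w) (f := fun q : V × ℝ => (-q.2, q.1))
      (by fun_prop)).contDiffOn)
  rw [Set.univ_prod_univ, contDiffOn_univ] at h
  have h2 := h.comp (f := fun x : V => (x, (0 : ℝ))) (by fun_prop)
  convert h2 using 1
  ext x
  simp only [Function.comp, convolution_def, zero_sub, neg_neg, ContinuousLinearMap.mul_apply']
  rw [intervalIntegral.integral_of_le ht, ← integral_indicator measurableSet_Ioc]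
  congr 1
  ext τ
  by_cases hτ : τ ∈ Set.Ioc 0 t <;> simp [hτ]

end TimeIntegral

section TestFunctions

open LineDeriv

variable {V : Type*} [NormedAddCommGroup V] [InnerProductSpace ℝ V]
    [FiniteDimensional ℝ V] [MeasurableSpace V] [BorelSpace V] (χ : LPF V)

/-- Real-valued smooth compactly supported functions. -/
def IsTest (f : V → ℝ) : Prop := ContDiff ℝ (⊤ : ℕ∞) f ∧ HasCompactSupport f

/-- The Besov norm of a real-valued function. -/
def rbesov (s p : ℝ) (f : V → ℝ) : ℝ≥0∞ := besov χ s p fun y => ((f y : ℝ) : ℂ)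

/-- The complexification of a test function, as a Schwartz function. -/
def IsTest.toS {f : V → ℝ} (hf : IsTest f) : 𝓢(V, ℂ) :=
  HasCompactSupport.toSchwartzMap (f := fun y => ((f y : ℝ) : ℂ))
    (hf.2.comp_left Complex.ofReal_zero) (Complex.ofRealCLM.contDiff.comp hf.1)

theorem IsTest.toS_apply {f : V → ℝ} (hf : IsTest f) (x : V) : hf.toS x = ((f x : ℝ) : ℂ) := rfl

theorem IsTest.rbesov_eq {f : V → ℝ} (hf : IsTest f) (s p : ℝ) :
    rbesov χ s p f = besov χ s p hf.toS := rfl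

theorem IsTest.mul {f g : V → ℝ} (hf : IsTest f) (hg : IsTest g) : IsTest fun x => f x * g x :=
  ⟨hf.1.mul hg.1, hf.2.mul_right⟩

theorem IsTest.const_mul {f : V → ℝ} (c : ℝ) (hf : IsTest f) : IsTest fun x => c * f x :=
  ⟨contDiff_const.mul hf.1, hf.2.mul_left⟩

theorem isTest_zero : IsTest fun _ : V => (0 : ℝ) := ⟨contDiff_const, HasCompactSupport.zero⟩

theorem IsTest.add {f g : V → ℝ} (hf : IsTest f) (hg : IsTest g) : IsTest fun x => f x + g x :=
  ⟨hf.1.add hg.1, hf.2.add hg.2⟩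

theorem IsTest.sum {ι : Type*} (S : Finset ι) {f : ι → V → ℝ} (hf : ∀ i ∈ S, IsTest (f i)) :
    IsTest fun x => ∑ i ∈ S, f i x := by
  classical
  induction S using Finset.induction_on with
  | empty => simpa using isTest_zero
  | insert a S ha ih =>
    simp only [Finset.sum_insert ha]
    exact (hf a (by simp)).add (ih fun i hi => hf i (by simp [hi]))

theorem rbesov_add_le {s p : ℝ} (hp : 1 < p) {f g : V → ℝ} (hf : IsTest f) (hg : IsTest g) :
    rbesov χ s p (fun x => f x + g x) ≤ rbesov χ s p f + rbesov χ s p g := by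
  rw [(hf.add hg).rbesov_eq, hf.rbesov_eq, hg.rbesov_eq, besov_eq, besov_eq, besov_eq,
    ← ENNReal.tsum_add]
  have h : (hf.add hg).toS = hf.toS + hg.toS := by
    ext x
    simp [IsTest.toS_apply]
  refine ENNReal.tsum_le_tsum fun k => ?_
  rw [h, op_add, ← mul_add]
  exact mul_le_mul' le_rfl (eLpNorm_add_le_ofReal hp _ _)

theorem rbesov_const_mul_le {s p : ℝ} (c : ℝ) {f : V → ℝ} (hf : IsTest f) :
    rbesov χ s p (fun x => c * f x) ≤ ‖c‖ₑ * rbesov χ s p f := by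
  rw [(hf.const_mul c).rbesov_eq, hf.rbesov_eq, besov_eq, besov_eq, ← ENNReal.tsum_mul_left]
  have h : (hf.const_mul c).toS = (c : ℂ) • hf.toS := by
    ext x
    simp [IsTest.toS_apply]
  refine ENNReal.tsum_le_tsum fun k => ?_
  have h2 : op χ.phiS k ((c : ℂ) • hf.toS) = (c : ℂ) • op χ.phiS k hf.toS := map_smul _ _ _
  have h3 : (((c : ℂ) • op χ.phiS k hf.toS : 𝓢(V, ℂ)) : V → ℂ) =
    (c : ℂ) • (op χ.phiS k hf.toS : V → ℂ) := rfl
  rw [h, h2, h3, eLpNorm_const_smul, mul_left_comm]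
  have h4 : ‖(c : ℂ)‖ₑ = ‖c‖ₑ := by
    rw [← ofReal_norm, ← ofReal_norm, Complex.norm_real]
  rw [h4]

theorem rbesov_zero (s p : ℝ) : rbesov χ s p (fun _ : V => (0 : ℝ)) = 0 := by
  have h : ∀ k, op χ.phiS k (isTest_zero (V := V)).toS = 0 := fun k => by
    apply ext_fourier
    intro ξ
    have : (isTest_zero (V := V)).toS = 0 := by ext x; simp [IsTest.toS_apply]
    rw [fourier_op, this]
    simp
  rw [isTest_zero.rbesov_eq, besov_eq]
  simp [h]

theorem rbesov_sum_le {s p : ℝ} (hp : 1 < p) {ι : Type*} (S : Finset ι) {f : ι → V → ℝ}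
    (hf : ∀ i ∈ S, IsTest (f i)) :
    rbesov χ s p (fun x => ∑ i ∈ S, f i x) ≤ ∑ i ∈ S, rbesov χ s p (f i) := by
  classical
  induction S using Finset.induction_on with
  | empty => simp [rbesov_zero]
  | insert a S ha ih =>
    simp only [Finset.sum_insert ha]
    have hS : ∀ i ∈ S, IsTest (f i) := fun i hi => hf i (by simp [hi])
    exact (rbesov_add_le χ hp (hf a (by simp)) (IsTest.sum S hS)).trans (add_le_add le_rfl (ih hS))

theorem exists_rbesov_mul_le [Nontrivial V] {p : ℝ} (hp : 1 < p) :
    ∃ C : ℝ≥0, ∀ f g : V → ℝ, IsTest f → IsTest g →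
      rbesov χ ((Module.finrank ℝ V : ℝ) / p) p (fun x => f x * g x) ≤
        C * (rbesov χ ((Module.finrank ℝ V : ℝ) / p) p f *
          rbesov χ ((Module.finrank ℝ V : ℝ) / p) p g) := by
  obtain ⟨C, hC⟩ := exists_besov_pmul_le χ hp
  refine ⟨C, fun f g hf hg => ?_⟩
  have h : (hf.mul hg).toS = pmul hf.toS hg.toS := by
    ext x
    simp [IsTest.toS_apply, pmul_apply]
  rw [(hf.mul hg).rbesov_eq, h]
  exact hC _ _

theorem IsTest.pow_mul {f g : V → ℝ} (hf : IsTest f) (hg : IsTest g) (n : ℕ) :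
    IsTest fun x => f x ^ n * g x :=
  ⟨(hf.1.pow n).mul hg.1, hg.2.mul_left⟩

theorem IsTest.prod_pow_mul {ι : Type*} (S : Finset ι) {f : ι → V → ℝ} (hf : ∀ i, IsTest (f i))
    {g : V → ℝ} (hg : IsTest g) (d : ι → ℕ) : IsTest fun x => (∏ i ∈ S, f i x ^ d i) * g x :=
  ⟨(contDiff_prod fun i _ => (hf i).1.pow (d i)).mul hg.1, hg.2.mul_left⟩

/-- A monomial in elements of the Besov algebra acts boundedly on the algebra. -/
theorem rbesov_prod_pow_mul_le {s p : ℝ} {C : ℝ≥0∞}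
    (hC : ∀ f g : V → ℝ, IsTest f → IsTest g →
      rbesov χ s p (fun x => f x * g x) ≤ C * (rbesov χ s p f * rbesov χ s p g))
    {ι : Type*} (S : Finset ι) {f : ι → V → ℝ} (hf : ∀ i, IsTest (f i))
    {g : V → ℝ} (hg : IsTest g) (d : ι → ℕ) {M : ℝ≥0∞} (hM : ∀ i, rbesov χ s p (f i) ≤ M) :
    rbesov χ s p (fun x => (∏ i ∈ S, f i x ^ d i) * g x) ≤
      (C * M) ^ (∑ i ∈ S, d i) * rbesov χ s p g := by
  classical
  have hpow : ∀ (i : ι) (n : ℕ) (g : V → ℝ), IsTest g →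
      rbesov χ s p (fun x => f i x ^ n * g x) ≤ (C * M) ^ n * rbesov χ s p g := by
    intro i n g hg
    induction n with
    | zero => simp
    | succ n ih =>
      calc rbesov χ s p (fun x => f i x ^ (n + 1) * g x)
          = rbesov χ s p (fun x => f i x * (f i x ^ n * g x)) := by
            congr 1; ext x; ring
        _ ≤ C * (rbesov χ s p (f i) * rbesov χ s p (fun x => f i x ^ n * g x)) :=
            hC _ _ (hf i) ((hf i).pow_mul hg n)
        _ ≤ C * (M * ((C * M) ^ n * rbesov χ s p g)) := by
            gcongr; exact hM i
        _ = _ := by ring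
  induction S using Finset.induction_on with
  | empty => simp
  | insert a S ha ih =>
    simp only [Finset.prod_insert ha, Finset.sum_insert ha, mul_assoc, pow_add]
    refine (hpow a (d a) _ (IsTest.prod_pow_mul S hf hg d)).trans ?_
    gcongr

end TestFunctions

section Euclidean

open LineDeriv

variable {N : ℕ} (χ : LPF (Euc N))

theorem IsTest.pdv {f : Euc N → ℝ} (hf : IsTest f) (i : Fin N) : IsTest fun y => pdv i f y :=
  ⟨(hf.1.fderiv_right (by simp)).clm_apply contDiff_const, hf.2.fderiv_apply ℝ _⟩

theorem IsTest.toS_pdv {f : Euc N → ℝ} (hf : IsTest f) (i : Fin N) :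
    (hf.pdv i).toS = (∂_{(EuclideanSpace.single i 1 : Euc N)} hf.toS : 𝓢(Euc N, ℂ)) := by
  ext y
  rw [SchwartzMap.lineDerivOp_apply_eq_fderiv, IsTest.toS_apply]
  have h : HasFDerivAt (hf.toS : Euc N → ℂ) (Complex.ofRealCLM.comp (fderiv ℝ f y)) y :=
    Complex.ofRealCLM.hasFDerivAt.comp y
      (hf.1.differentiable (by simp)).differentiableAt.hasFDerivAt
  rw [h.fderiv]
  rfl

theorem exists_rbesov_pdv_le {p : ℝ} (hp : 1 < p) (s : ℝ) :
    ∃ C : ℝ≥0, ∀ (i : Fin N) (f : Euc N → ℝ), IsTest f →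
      rbesov χ (-1 + s) p (fun y => pdv i f y) ≤ C * rbesov χ s p f := by
  choose C hC using fun i : Fin N => exists_besov_lineDeriv_le χ hp s (EuclideanSpace.single i 1)
  refine ⟨∑ i, C i, fun i f hf => ?_⟩
  rw [(hf.pdv i).rbesov_eq, hf.toS_pdv, hf.rbesov_eq]
  refine (hC i _).trans (mul_le_mul' ?_ le_rfl)
  exact_mod_cast Finset.single_le_sum (f := C) (fun _ _ => zero_le) (Finset.mem_univ i)

theorem exists_rbesov_le_sum_pdv {p : ℝ} (hp : 1 < p) (s : ℝ) :
    ∃ C : ℝ≥0, ∀ f : Euc N → ℝ, IsTest f →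
      rbesov χ s p f ≤ C * ∑ i, rbesov χ (-1 + s) p (fun y => pdv i f y) := by
  obtain ⟨C, hC⟩ := exists_besov_le_sum_lineDeriv χ (EuclideanSpace.basisFun (Fin N) ℝ) hp s
  refine ⟨C, fun f hf => ?_⟩
  rw [hf.rbesov_eq]
  refine (hC hf.toS).trans (mul_le_mul' le_rfl (Finset.sum_le_sum fun i _ => ?_))
  rw [(hf.pdv i).rbesov_eq, hf.toS_pdv, EuclideanSpace.basisFun_apply]

/-- Smooth compactly supported functions of time and space. -/
def IsSTest (w : ℝ → Euc N → ℝ) : Prop :=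
  ContDiff ℝ (⊤ : ℕ∞) (Function.uncurry w) ∧ HasCompactSupport (Function.uncurry w)

theorem IsSTest.isTest {w : ℝ → Euc N → ℝ} (hw : IsSTest w) (t : ℝ) : IsTest (w t) :=
  ⟨hw.1.comp (g := Function.uncurry w) (f := fun y => (t, y)) (by fun_prop),
    HasCompactSupport.intro (hw.2.isCompact.image continuous_snd) fun y hy => by
      by_contra h
      exact hy ⟨(t, y), subset_tsupport _ h, rfl⟩⟩

theorem IsSTest.pdv {w : ℝ → Euc N → ℝ} (hw : IsSTest w) (i : Fin N) :
    IsSTest fun t y => pdv i (w t) y := by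
  have h : (Function.uncurry fun t y => MHD.pdv i (w t) y) =
      fun q => fderiv ℝ (Function.uncurry w) q (0, EuclideanSpace.single i 1) := by
    ext ⟨t, y⟩
    have h1 := (hw.1.differentiable (by simp)).differentiableAt (x := (t, y))
    have h2 : HasFDerivAt (w t) ((fderiv ℝ (Function.uncurry w) (t, y)).comp
        (ContinuousLinearMap.inr ℝ ℝ (Euc N))) y :=
      h1.hasFDerivAt.comp y (hasFDerivAt_prodMk_right t y)
    simp [MHD.pdv, h2.fderiv]
  rw [IsSTest, h]
  exact ⟨(hw.1.fderiv_right (by simp)).clm_apply contDiff_const, hw.2.fderiv_apply ℝ _⟩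

theorem SmoothCpt.isSTest {u : ℝ → Euc N → Euc N} (hu : SmoothCpt N u) (m : Fin N) :
    IsSTest fun t y => u t y m :=
  ⟨ContDiff.comp (g := fun z : Euc N => z m) (f := Function.uncurry u)
      (EuclideanSpace.proj (𝕜 := ℝ) m).contDiff hu.1,
    hu.2.1.comp_left (g := fun z : Euc N => z m) rfl⟩

theorem IsSTest.continuous_toS {w : ℝ → Euc N → ℝ} (hw : IsSTest w) :
    Continuous fun q : ℝ × Euc N => (hw.isTest q.1).toS q.2 :=
  Continuous.comp (g := fun r : ℝ => (r : ℂ)) (f := Function.uncurry w)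
    Complex.continuous_ofReal hw.1.continuous

theorem IsSTest.hasCompactSupport_toS {w : ℝ → Euc N → ℝ} (hw : IsSTest w) :
    HasCompactSupport fun q : ℝ × Euc N => (hw.isTest q.1).toS q.2 :=
  HasCompactSupport.comp_left (g := fun r : ℝ => (r : ℂ)) (f := Function.uncurry w) hw.2
    Complex.ofReal_zero

theorem IsSTest.measurable_rbesov {w : ℝ → Euc N → ℝ} (hw : IsSTest w) (s : ℝ) {p : ℝ}
    (hp : 0 < p) : Measurable fun t => rbesov χ s p (w t) :=
  measurable_besov χ (w := fun t => (hw.isTest t).toS) hp hw.continuous_toS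

theorem IsSTest.isTest_intervalIntegral {w : ℝ → Euc N → ℝ} (hw : IsSTest w) {t : ℝ}
    (ht : 0 ≤ t) : IsTest fun y => ∫ τ in (0 : ℝ)..t, w τ y :=
  ⟨contDiff_intervalIntegral hw.1 hw.2 ht,
    HasCompactSupport.intro (hw.2.isCompact.image continuous_snd) fun y hy => by
      have : ∀ τ, w τ y = 0 := fun τ => by
        by_contra h
        exact hy ⟨(τ, y), subset_tsupport _ h, rfl⟩
      simp [this]⟩

theorem IsSTest.rbesov_intervalIntegral_le {w : ℝ → Euc N → ℝ} (hw : IsSTest w) (s : ℝ) {p : ℝ}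
    (hp : 1 < p) {t : ℝ} (ht : 0 ≤ t) :
    rbesov χ s p (fun y => ∫ τ in (0 : ℝ)..t, w τ y) ≤
      ∫⁻ τ in Set.Ioi 0, rbesov χ s p (w τ) := by
  rw [(hw.isTest_intervalIntegral ht).rbesov_eq]
  refine besov_intervalIntegral_le χ (w := fun t => (hw.isTest t).toS) hp
    hw.continuous_toS hw.hasCompactSupport_toS ht fun y => ?_
  rw [IsTest.toS_apply, ← intervalIntegral.integral_ofReal]
  rfl

end Euclidean

section Cofactor

theorem totalDegree_adjugate_le {N : ℕ} (i j : Fin N) :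
    (Matrix.adjugate (1 + Matrix.of fun a b => MvPolynomial.X (R := ℝ) (a, b)) i j :
      MvPolynomial (Fin N × Fin N) ℝ).totalDegree ≤ N - 1 := by
  rw [Matrix.adjugate_apply, Matrix.det_apply]
  refine MvPolynomial.totalDegree_finsetSum_le fun σ _ => ?_
  refine (MvPolynomial.totalDegree_smul_le _ _).trans ?_
  refine (MvPolynomial.totalDegree_finsetProd _ _).trans ?_
  refine (Finset.sum_le_sum (g := fun a => if a = σ.symm j then 0 else 1) fun a _ => ?_).trans ?_
  · split_ifs with h
    · subst h
      rw [Equiv.apply_symm_apply, Matrix.updateRow_self, Pi.single_apply]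
      split_ifs <;> simp
    · have h' : σ a ≠ j := fun h' => h (by rw [← h', Equiv.symm_apply_apply])
      rw [Matrix.updateRow_ne h', Matrix.add_apply, Matrix.one_apply]
      refine (MvPolynomial.totalDegree_add _ _).trans (max_le ?_ ?_)
      · split_ifs <;> simp
      · simp
  · simp [Finset.sum_ite, Finset.filter_ne', Finset.card_erase_of_mem]

/-- The cofactor polynomials only have monomials of degree between `1` and `N - 1`. -/
theorem IsCofactorPoly.degree_mem {N : ℕ} {Q : Fin N → Fin N → MvPolynomial (Fin N × Fin N) ℝ}
    (hQ : IsCofactorPoly N Q) (i j : Fin N) {d : Fin N × Fin N →₀ ℕ} (hd : d ∈ (Q i j).support) :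
    ∑ v, d v ∈ Finset.Icc 1 (N - 1) := by
  obtain ⟨h0, hadj⟩ := hQ i j
  have hQe : Q i j = Matrix.adjugate (1 + Matrix.of fun a b => MvPolynomial.X (R := ℝ) (a, b)) i j -
      MvPolynomial.C (if i = j then (1 : ℝ) else 0) := by
    refine MvPolynomial.funext fun x => ?_
    rw [map_sub, MvPolynomial.eval_C, eq_sub_iff_add_eq, add_comm]
    have h1 := hadj (Matrix.of fun a b => x (a, b))
    simp only [Matrix.of_apply, Prod.mk.eta] at h1
    rw [← h1]
    have h2 := congrFun (congrFun ((MvPolynomial.eval x).map_adjugate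
      (1 + Matrix.of fun a b => MvPolynomial.X (R := ℝ) (a, b))) i) j
    rw [RingHom.mapMatrix_apply, Matrix.map_apply] at h2
    rw [h2, map_add, map_one]
    congr 2
    ext a b
    simp
  have hdeg : (Q i j).totalDegree ≤ N - 1 := by
    rw [hQe]
    refine (MvPolynomial.totalDegree_sub_C_le _ _).trans (totalDegree_adjugate_le i j)
  rw [Finset.mem_Icc]
  constructor
  · by_contra h
    have hd0 : d = 0 := by
      ext v
      have := Finset.single_le_sum (f := d) (fun _ _ => Nat.zero_le _) (Finset.mem_univ v)
      simp only [Finsupp.coe_zero, Pi.zero_apply]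
      omega
    rw [hd0, MvPolynomial.mem_support_iff] at hd
    exact hd h0
  · have := MvPolynomial.le_totalDegree hd
    rw [Finsupp.sum_fintype _ _ (fun _ => rfl)] at this
    exact this.trans hdeg

end Cofactor

section GradientEstimate

variable {N : ℕ} (χ : LPF (Euc N))

theorem exists_lintegral_rbesov_le {p : ℝ} (hp : 1 < p) (s : ℝ) :
    ∃ C : ℝ≥0, ∀ w : ℝ → Euc N → ℝ, IsSTest w →
      ∫⁻ t in Set.Ioi 0, rbesov χ s p (w t) ≤
        C * ∑ i, ∫⁻ t in Set.Ioi 0, rbesov χ (-1 + s) p (fun y => pdv i (w t) y) := by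
  obtain ⟨C, hC⟩ := exists_rbesov_le_sum_pdv χ hp s
  refine ⟨C, fun w hw => (lintegral_mono fun t => hC _ (hw.isTest t)).trans ?_⟩
  rw [lintegral_const_mul' _ _ ENNReal.coe_ne_top, lintegral_finsetSum]
  exact fun i _ => (hw.pdv i).measurable_rbesov χ _ (by linarith)

theorem EE_eq (s p : ℝ) (u : ℝ → Euc N → Euc N) :
    EE χ s p u = ∑ m : Fin N, ∑ j : Fin N, ∑ i : Fin N,
      ∫⁻ t in Set.Ioi 0, rbesov χ s p (fun y => pdv i (pdv j fun z => u t z m) y) :=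
  Finset.sum_congr rfl fun _ _ => Finset.sum_comm

theorem exists_rbesov_integral_pdv_le {p : ℝ} (hp : 1 < p) (s : ℝ) :
    ∃ C : ℝ≥0, ∀ u : ℝ → Euc N → Euc N, SmoothCpt N u → ∀ t : ℝ, 0 ≤ t →
      ∀ v : Fin N × Fin N,
        rbesov χ s p (fun y => ∫ τ in (0 : ℝ)..t, pdv v.2 (fun z => u τ z v.1) y) ≤
          C * EE χ (-1 + s) p u := by
  obtain ⟨C, hC⟩ := exists_lintegral_rbesov_le χ hp s
  refine ⟨C, fun u hu t ht v => ?_⟩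
  have hw := (hu.isSTest v.1).pdv v.2
  refine (hw.rbesov_intervalIntegral_le χ s hp ht).trans ((hC _ hw).trans ?_)
  rw [EE_eq]
  refine mul_le_mul' le_rfl ?_
  refine le_trans ?_ (Finset.single_le_sum (fun _ _ => zero_le) (Finset.mem_univ v.1))
  exact Finset.single_le_sum (f := fun j => ∑ i : Fin N, ∫⁻ t in Set.Ioi 0,
    rbesov χ (-1 + s) p (fun y => pdv i (pdv j fun z => u t z v.1) y))
    (fun _ _ => zero_le) (Finset.mem_univ v.2)

/-- The `Ḃ^{N/p}_{p,1}` bound for a product of a cofactor polynomial with a test function. -/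
theorem exists_rbesov_Pmat_mul_le (hN : 2 ≤ N) {p : ℝ} (hp : 1 < p)
    {Q : Fin N → Fin N → MvPolynomial (Fin N × Fin N) ℝ} (hQ : IsCofactorPoly N Q) :
    ∃ C : ℝ≥0, ∀ u : ℝ → Euc N → Euc N, SmoothCpt N u → ∀ t : ℝ, 0 ≤ t → ∀ k i : Fin N,
      ∀ g : Euc N → ℝ, IsTest g →
        IsTest (fun y => Pmat Q u t y k i * g y) ∧
        rbesov χ (N / p) p (fun y => Pmat Q u t y k i * g y) ≤
          C * (∑ r ∈ Finset.Icc 1 (N - 1), EE χ (-1 + N / p) p u ^ r) * rbesov χ (N / p) p g := by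
  have : Nontrivial (Euc N) := by
    have : Nonempty (Fin N) := ⟨⟨0, by omega⟩⟩
    infer_instance
  obtain ⟨K, hK⟩ := exists_rbesov_mul_le χ hp
  rw [finrank_euclideanSpace_fin] at hK
  obtain ⟨G, hG⟩ := exists_rbesov_integral_pdv_le χ hp (N / p)
  set A : Fin N → Fin N → ℝ≥0 := fun k i => ∑ d ∈ (Q k i).support,
    ‖(Q k i).coeff d‖₊ * (K * G) ^ (∑ v, d v) with hA
  refine ⟨∑ k, ∑ i, A k i, fun u hu t ht k i g hg => ?_⟩
  set E := EE χ (-1 + N / p) p u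
  set F : Fin N × Fin N → Euc N → ℝ :=
    fun v y => ∫ τ in (0 : ℝ)..t, pdv v.2 (fun z => u τ z v.1) y with hFdef
  have hF : ∀ v, IsTest (F v) := fun v =>
    ((hu.isSTest v.1).pdv v.2).isTest_intervalIntegral ht
  have hexp : (fun y => Pmat Q u t y k i * g y) = fun y => ∑ d ∈ (Q k i).support,
      (Q k i).coeff d * ((∏ v, F v y ^ d v) * g y) := by
    ext y
    rw [Pmat, MvPolynomial.eval_eq', Finset.sum_mul]
    simp only [mul_assoc, hFdef]
  have hterm : ∀ d : Fin N × Fin N →₀ ℕ, IsTest fun y => (∏ v, F v y ^ d v) * g y :=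
    fun d => IsTest.prod_pow_mul _ hF hg d
  rw [hexp]
  refine ⟨IsTest.sum _ fun d _ => (hterm d).const_mul _, ?_⟩
  refine (rbesov_sum_le χ hp _ fun d _ => (hterm d).const_mul _).trans ?_
  have hbound : ∀ d ∈ (Q k i).support,
      rbesov χ (N / p) p (fun y => (Q k i).coeff d * ((∏ v, F v y ^ d v) * g y)) ≤
        (‖(Q k i).coeff d‖₊ * (K * G) ^ (∑ v, d v) : ℝ≥0) *
          ((∑ r ∈ Finset.Icc 1 (N - 1), E ^ r) * rbesov χ (N / p) p g) := by
    intro d hd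
    refine (rbesov_const_mul_le χ _ (hterm d)).trans ?_
    rw [ENNReal.coe_mul, mul_assoc, enorm_eq_nnnorm]
    refine mul_le_mul' le_rfl ?_
    refine (rbesov_prod_pow_mul_le χ hK Finset.univ hF hg d (hG u hu t ht)).trans ?_
    rw [← mul_assoc, mul_pow, ← mul_assoc, ENNReal.coe_pow, ENNReal.coe_mul]
    refine mul_le_mul' (mul_le_mul' le_rfl ?_) le_rfl
    exact (Finset.single_le_sum (f := fun r => E ^ r) (fun _ _ => zero_le)
      (hQ.degree_mem k i hd))
  refine (Finset.sum_le_sum hbound).trans ?_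
  rw [← Finset.sum_mul, mul_assoc]
  refine mul_le_mul' ?_ le_rfl
  rw [← ENNReal.ofNNReal_finsetSum]
  have h1 : A k i ≤ ∑ i, A k i :=
    Finset.single_le_sum (f := fun i => A k i) (fun _ _ => zero_le) (Finset.mem_univ i)
  have h2 : ∑ i, A k i ≤ ∑ k, ∑ i, A k i :=
    Finset.single_le_sum (f := fun k => ∑ i, A k i) (fun _ _ => zero_le) (Finset.mem_univ k)
  exact_mod_cast h1.trans h2

end GradientEstimate

end Auxiliary

end MHD

/-- **estimate (3.17).** For `N ≤ p < 2N − 1`,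
`‖∇V₆(u,B)‖_{L¹(ℝ₊;Ḃ^{−1+N/p}_{p,1})}
  ≤ C (∑_{r=1}^{N−1} E(u)^r) ‖D²B‖_{L¹(ℝ₊;Ḃ^{−1+N/p}_{p,1})}`, where
`V₆(u,B) = ∑_{i,k} P_{ki} ∂_k B_i`. -/
theorem V6_gradient_estimate
    (N : ℕ) (hN : 2 ≤ N) (p : ℝ) (hp1 : (N : ℝ) ≤ p) (hp2 : p < 2 * N - 1)
    (χ : LPF (Euc N))
    (Q : Fin N → Fin N → MvPolynomial (Fin N × Fin N) ℝ) (hQ : IsCofactorPoly N Q) :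
    ∃ C : ℝ, 0 < C ∧
      ∀ u B : ℝ → Euc N → Euc N, SmoothCpt N u → SmoothCpt N B →
        (∑ ℓ : Fin N, besovT χ (-1 + N / p) p (Set.Ioi 0) (fun t y =>
          ((pdv ℓ (fun z => ∑ i : Fin N, ∑ k : Fin N,
              Pmat Q u t z k i * pdv k (fun z' => B t z' i) z) y : ℝ) : ℂ))) ≤
        ENNReal.ofReal C *
          (∑ r ∈ Finset.Icc 1 (N - 1), EE χ (-1 + N / p) p u ^ r) *
          EE χ (-1 + N / p) p B := by
  have hp : 1 < p := by
    have : (2 : ℝ) ≤ N := by exact_mod_cast hN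
    linarith
  obtain ⟨A, hA⟩ := exists_rbesov_Pmat_mul_le χ hN hp hQ
  obtain ⟨D, hD⟩ := exists_rbesov_pdv_le χ hp (N / p)
  obtain ⟨G, hG⟩ := exists_lintegral_rbesov_le χ hp (N / p)
  refine ⟨(N * (D * (A * G)) : NNReal) + 1, by positivity, fun u B hu hB => ?_⟩
  set S := ∑ r ∈ Finset.Icc 1 (N - 1), EE χ (-1 + N / p) p u ^ r
  have hdB : ∀ i k : Fin N, IsSTest fun t y => pdv k (fun z => B t z i) y :=
    fun i k => (hB.isSTest i).pdv k
  have hpt : ∀ ℓ : Fin N, ∀ t ∈ Set.Ioi (0 : ℝ),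
      rbesov χ (-1 + N / p) p (fun y => pdv ℓ (fun z => ∑ i : Fin N, ∑ k : Fin N,
        Pmat Q u t z k i * pdv k (fun z' => B t z' i) z) y) ≤
      (D * (A * S)) * ∑ i : Fin N, ∑ k : Fin N,
        rbesov χ (N / p) p (fun y => pdv k (fun z => B t z i) y) := by
    intro ℓ t ht
    have hA' := fun k i => hA u hu t (le_of_lt ht) k i _ ((hdB i k).isTest t)
    have hinner : ∀ i : Fin N, IsTest fun y => ∑ k : Fin N,
        Pmat Q u t y k i * pdv k (fun z' => B t z' i) y :=
      fun i => IsTest.sum _ fun k _ => (hA' k i).1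
    refine (hD ℓ _ (IsTest.sum _ fun i _ => hinner i)).trans ?_
    rw [mul_assoc]
    refine mul_le_mul' le_rfl ((rbesov_sum_le χ hp _ fun i _ => hinner i).trans ?_)
    rw [Finset.mul_sum]
    refine Finset.sum_le_sum fun i _ => (rbesov_sum_le χ hp _ fun k _ => (hA' k i).1).trans ?_
    rw [Finset.mul_sum]
    exact Finset.sum_le_sum fun k _ => (hA' k i).2
  have hmeas : ∀ i k : Fin N, Measurable fun t =>
      rbesov χ (N / p) p (fun y => pdv k (fun z => B t z i) y) :=
    fun i k => (hdB i k).measurable_rbesov χ _ (by linarith)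
  have hbd : ∀ ℓ : Fin N, besovT χ (-1 + N / p) p (Set.Ioi 0) (fun t y =>
      ((pdv ℓ (fun z => ∑ i : Fin N, ∑ k : Fin N,
        Pmat Q u t z k i * pdv k (fun z' => B t z' i) z) y : ℝ) : ℂ)) ≤
      (D * (A * S)) * (G * EE χ (-1 + N / p) p B) := by
    intro ℓ
    refine (setLIntegral_mono' measurableSet_Ioi (hpt ℓ)).trans ?_
    rw [lintegral_const_mul _ (Finset.measurable_fun_sum _ fun i _ =>
      Finset.measurable_fun_sum _ fun k _ => hmeas i k)]
    refine mul_le_mul' le_rfl ?_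
    rw [lintegral_finsetSum _ fun i _ => Finset.measurable_fun_sum _ fun k _ => hmeas i k, EE_eq,
      Finset.mul_sum]
    refine Finset.sum_le_sum fun i _ => ?_
    rw [lintegral_finsetSum _ fun k _ => hmeas i k, Finset.mul_sum]
    exact Finset.sum_le_sum fun k _ => hG _ (hdB i k)
  refine (Finset.sum_le_sum fun ℓ _ => hbd ℓ).trans ?_
  rw [Finset.sum_const, Finset.card_univ, Fintype.card_fin, nsmul_eq_mul]
  calc (N : ℝ≥0∞) * (D * (A * S) * (G * EE χ (-1 + N / p) p B))
      = ((N * (D * (A * G)) : NNReal) : ℝ≥0∞) * S * EE χ (-1 + N / p) p B := by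
        push_cast
        ring
    _ ≤ _ := by
        gcongr
        rw [← ENNReal.ofReal_coe_nnreal]
        exact ENNReal.ofReal_le_ofReal (by linarith)
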